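/- arXiv:1110.1360 — 6 statements merged into one kernel-verified Lean document; each statement's English description precedes it below -/
import Mathlib

section
/- There exist absolute constants c, c' > 0 such that for all sufficiently large n and every integer L with 3 ≤ L ≤ (log n)/(10 log log n), there is a simple graph G on n vertices such that, with k = ⌊√n⌋: (i) the L-level Sherali–Adams relaxation SA_L for Densest k-subgraph on G is feasible with objective value d ≥ c·n^{1/4}/L; and (ii) every induced subgraph of G on k vertices has average degree at most c'·(log n)^2. Consequently the integrality gap of SA_L on n-vertex graphs is at least Ω(n^{1/4}/(L·(log n)^2)). -/
open Classical in
/-- Feasibility, with value `d`, of the `L`-level Sherali–Adams relaxation `SA_L` for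
Densest `k`-subgraph on a graph `G` on `n` vertices: there is
`x : Finset (Fin n) → ℝ` with `x ∅ = 1` such that for all disjoint `S, T` with
`|S| + |T| ≤ L`, the size constraint (a), the density constraints (b), and the
inclusion–exclusion constraints (c) hold. -/
def SAFeasible (n : ℕ) (G : SimpleGraph (Fin n)) (L : ℕ) (k d : ℝ) : Prop :=
  ∃ x : Finset (Fin n) → ℝ, x ∅ = 1 ∧
    ∀ S T : Finset (Fin n), Disjoint S T → S.card + T.card ≤ L →
      ((∑ i : Fin n, ∑ J ∈ T.powerset, (-1 : ℝ) ^ J.card * x (insert i (S ∪ J))) ≤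
          k * ∑ J ∈ T.powerset, (-1 : ℝ) ^ J.card * x (S ∪ J)) ∧
      (∀ i : Fin n,
        d * ∑ J ∈ T.powerset, (-1 : ℝ) ^ J.card * x (insert i (S ∪ J)) ≤
          ∑ j : Fin n, if G.Adj i j then
            (∑ J ∈ T.powerset, (-1 : ℝ) ^ J.card * x (insert j (insert i (S ∪ J))))
          else 0) ∧
      (0 ≤ ∑ J ∈ T.powerset, (-1 : ℝ) ^ J.card * x (S ∪ J) ∧
        ∑ J ∈ T.powerset, (-1 : ℝ) ^ J.card * x (S ∪ J) ≤ 1)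

section KilledWalk

variable {V : Type*} [Fintype V] [DecidableEq V] (G : SimpleGraph V) [DecidableRel G.Adj] (D : ℝ)

/-- The contribution of the particle at `j` to one step of coalescing walks with killing, run from
the configuration `S`. -/
noncomputable def particleStep (z : Finset V → ℝ) (S : Finset V) (j : V) : ℝ :=
  1 / (Fintype.card V : ℝ) * z (S.erase j) +
    1 / (2 * D) * ∑ i, if G.Adj j i then z (insert i (S.erase j)) else 0

/-- One step of coalescing walks with killing: a uniformly random particle of `S` moves. -/
noncomputable def walkStep (z : Finset V → ℝ) (S : Finset V) : ℝ :=
  if S = ∅ then 1 else (∑ j ∈ S, particleStep G D z S j) / S.card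

/-- The properties preserved by `walkStep`. -/
structure IsSubharmonic (z : Finset V → ℝ) : Prop where
  nonneg : ∀ S, 0 ≤ z S
  empty : z ∅ = 1
  insert_le : ∀ S i, z (insert i S) ≤ z S
  sum_insert_le : ∀ S : Finset V, ∑ j, z (insert j S) ≤ 2 * ((S.card : ℝ) + 1) ^ 2 * z S
  le_walkStep : ∀ S, z S ≤ walkStep G D z S

variable {G D}

lemma sum_ite_adj_nonneg {z : Finset V → ℝ} (h : ∀ S, 0 ≤ z S) (S : Finset V) (j : V) :
    0 ≤ ∑ i, if G.Adj j i then z (insert i S) else 0 :=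
  Finset.sum_nonneg fun i _ => by split_ifs; exacts [h _, le_rfl]

lemma particleStep_mono (hD : 0 < D) {z w : Finset V → ℝ} (h : ∀ S, z S ≤ w S) (S : Finset V)
    (j : V) : particleStep G D z S j ≤ particleStep G D w S j := by
  unfold particleStep
  gcongr with i
  · exact h _
  · split_ifs
    · exact h _
    · exact le_rfl

lemma walkStep_mono (hD : 0 < D) {z w : Finset V → ℝ} (h : ∀ S, z S ≤ w S) (S : Finset V) :
    walkStep G D z S ≤ walkStep G D w S := by
  unfold walkStep
  split_ifs
  · exact le_rfl
  · gcongr with j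
    exact particleStep_mono hD h S j

lemma card_mul_walkStep (z : Finset V → ℝ) (S : Finset V) :
    S.card * walkStep G D z S = ∑ j ∈ S, particleStep G D z S j := by
  unfold walkStep
  split_ifs with h
  · simp [h]
  · have : (S.card : ℝ) ≠ 0 := by simpa using h
    field_simp

lemma particleStep_nonneg (hD : 0 < D) {z : Finset V → ℝ} (h : ∀ S, 0 ≤ z S) (S : Finset V)
    (j : V) : 0 ≤ particleStep G D z S j := by
  unfold particleStep
  have := sum_ite_adj_nonneg (G := G) h (S.erase j) j
  have := h (S.erase j)
  positivity

lemma walkStep_nonneg (hD : 0 < D) {z : Finset V → ℝ} (h : ∀ S, 0 ≤ z S) (S : Finset V) :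
    0 ≤ walkStep G D z S := by
  unfold walkStep
  split_ifs
  · exact zero_le_one
  · exact div_nonneg (Finset.sum_nonneg fun j _ => particleStep_nonneg hD h S j) (by positivity)

lemma particleStep_insert_self_le (hD : 0 < D) (hV : 2 ≤ Fintype.card V)
    (hdeg : ∀ j, ∑ i, (if G.Adj j i then (1 : ℝ) else 0) ≤ D)
    {z : Finset V → ℝ} (hz : IsSubharmonic G D z) {S : Finset V} {j : V} (hj : j ∉ S) :
    particleStep G D z (insert j S) j ≤ z S := by
  unfold particleStep
  rw [Finset.erase_insert hj]
  have h1 : ∑ i, (if G.Adj j i then z (insert i S) else 0) ≤ D * z S := by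
    calc _ ≤ ∑ i, (if G.Adj j i then (1 : ℝ) else 0) * z S := by
          gcongr with i
          split_ifs
          · simpa using hz.insert_le S i
          · simp
      _ = (∑ i, (if G.Adj j i then (1 : ℝ) else 0)) * z S := by rw [Finset.sum_mul]
      _ ≤ _ := by gcongr; exacts [hz.nonneg S, hdeg j]
  have h2 : 1 / (Fintype.card V : ℝ) ≤ 1 / 2 := by
    gcongr; exact_mod_cast hV
  calc _ ≤ 1 / 2 * z S + 1 / (2 * D) * (D * z S) := by
        gcongr; exact hz.nonneg S
    _ = z S := by field_simp; ring

lemma particleStep_insert_of_ne_le (hD : 0 < D)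
    {z : Finset V → ℝ} (hz : IsSubharmonic G D z) {S : Finset V} {i j : V} (hij : j ≠ i) :
    particleStep G D z (insert j S) i ≤ particleStep G D z S i := by
  unfold particleStep
  rw [Finset.erase_insert_of_ne hij]
  gcongr with k
  · exact hz.insert_le _ _
  · split_ifs
    · rw [Finset.insert_comm]; exact hz.insert_le _ _
    · exact le_rfl

lemma sum_particleStep_insert_le (hD : 0 < D)
    {z : Finset V → ℝ} (hz : IsSubharmonic G D z) {S : Finset V} {i : V} (hi : i ∈ S) :
    ∑ j ∈ Sᶜ, particleStep G D z (insert j S) i ≤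
      2 * ((S.card : ℝ) + 1) ^ 2 * particleStep G D z S i := by
  have key : ∀ T : Finset V, T.card ≤ S.card →
      ∑ j, z (insert j T) ≤ 2 * ((S.card : ℝ) + 1) ^ 2 * z T := fun T hT =>
    (hz.sum_insert_le T).trans (by gcongr; exact hz.nonneg T)
  have hne : ∀ j ∈ Sᶜ, j ≠ i := by rintro j hj rfl; simp [hi] at hj
  calc ∑ j ∈ Sᶜ, particleStep G D z (insert j S) i
      = ∑ j ∈ Sᶜ, (1 / (Fintype.card V : ℝ) * z (insert j (S.erase i)) +
        1 / (2 * D) * ∑ k, if G.Adj i k then z (insert k (insert j (S.erase i))) else 0) := by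
        refine Finset.sum_congr rfl fun j hj => ?_
        unfold particleStep
        rw [Finset.erase_insert_of_ne (hne j hj)]
    _ ≤ ∑ j, (1 / (Fintype.card V : ℝ) * z (insert j (S.erase i)) +
        1 / (2 * D) * ∑ k, if G.Adj i k then z (insert k (insert j (S.erase i))) else 0) := by
        refine Finset.sum_le_sum_of_subset_of_nonneg (Finset.subset_univ _) fun j _ _ => ?_
        have h1 := hz.nonneg (insert j (S.erase i))
        have := sum_ite_adj_nonneg (G := G) hz.nonneg (insert j (S.erase i)) i
        positivity
    _ = 1 / (Fintype.card V : ℝ) * ∑ j, z (insert j (S.erase i)) +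
        1 / (2 * D) * ∑ k, if G.Adj i k then ∑ j, z (insert j (insert k (S.erase i))) else 0 := by
        rw [Finset.sum_add_distrib, ← Finset.mul_sum, ← Finset.mul_sum, Finset.sum_comm]
        congr 2
        refine Finset.sum_congr rfl fun k _ => ?_
        split_ifs
        · simp only [Finset.insert_comm k]
        · simp
    _ ≤ 1 / (Fintype.card V : ℝ) * (2 * ((S.card : ℝ) + 1) ^ 2 * z (S.erase i)) +
        1 / (2 * D) * ∑ k, if G.Adj i k then
          2 * ((S.card : ℝ) + 1) ^ 2 * z (insert k (S.erase i)) else 0 := by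
        gcongr with k
        · exact key _ (Finset.card_erase_le)
        · split_ifs
          · refine key _ ((Finset.card_insert_le _ _).trans ?_)
            rw [Finset.card_erase_add_one hi]
          · exact le_rfl
    _ = _ := by
        unfold particleStep
        rw [mul_add, Finset.mul_sum, Finset.mul_sum, Finset.mul_sum]
        congr 1
        · ring
        · refine Finset.sum_congr rfl fun k _ => ?_
          split_ifs
          · ring
          · simp

lemma sum_particleStep_insert_self_le (hD : 0 < D) (hV : 2 ≤ Fintype.card V)
    (hdeg : ∀ j, ∑ i, (if G.Adj j i then (1 : ℝ) else 0) ≤ D)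
    {z : Finset V → ℝ} (hz : IsSubharmonic G D z) (S : Finset V) :
    ∑ j ∈ Sᶜ, particleStep G D z (insert j S) j ≤ (1 + ((S.card : ℝ) + 1) ^ 2) * z S := by
  have hn : (0 : ℝ) < Fintype.card V := by exact_mod_cast (by omega : 0 < Fintype.card V)
  calc ∑ j ∈ Sᶜ, particleStep G D z (insert j S) j
      = ∑ j ∈ Sᶜ, (1 / (Fintype.card V : ℝ) * z S +
        1 / (2 * D) * ∑ i, if G.Adj j i then z (insert i S) else 0) := by
        refine Finset.sum_congr rfl fun j hj => ?_
        unfold particleStep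
        rw [Finset.erase_insert (by simpa using hj)]
    _ ≤ ∑ j : V, (1 / (Fintype.card V : ℝ) * z S +
        1 / (2 * D) * ∑ i, if G.Adj j i then z (insert i S) else 0) := by
        refine Finset.sum_le_sum_of_subset_of_nonneg (Finset.subset_univ _) fun j _ _ => ?_
        have := hz.nonneg S
        have := sum_ite_adj_nonneg (G := G) hz.nonneg S j
        positivity
    _ = z S + 1 / (2 * D) * ∑ i, (∑ j, if G.Adj i j then (1 : ℝ) else 0) * z (insert i S) := by
        rw [Finset.sum_add_distrib, ← Finset.mul_sum, ← Finset.mul_sum, Finset.sum_comm]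
        congr 1
        · simp
          field_simp
        · congr 1
          refine Finset.sum_congr rfl fun i _ => ?_
          rw [Finset.sum_mul]
          refine Finset.sum_congr rfl fun j _ => ?_
          simp [G.adj_comm i j]
    _ ≤ z S + 1 / (2 * D) * ∑ i, D * z (insert i S) := by
        gcongr with i
        · exact hz.nonneg _
        · exact hdeg i
    _ = z S + 1 / 2 * ∑ i, z (insert i S) := by
        rw [← Finset.mul_sum]; field_simp
    _ ≤ z S + 1 / 2 * (2 * ((S.card : ℝ) + 1) ^ 2 * z S) := by
        gcongr; exact hz.sum_insert_le S
    _ = _ := by ring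

lemma isSubharmonic_walkStep (hD : 0 < D) (hV : 2 ≤ Fintype.card V)
    (hdeg : ∀ j, ∑ i, (if G.Adj j i then (1 : ℝ) else 0) ≤ D)
    {z : Finset V → ℝ} (hz : IsSubharmonic G D z) : IsSubharmonic G D (walkStep G D z) where
  nonneg := walkStep_nonneg hD hz.nonneg
  empty := by simp [walkStep]
  insert_le S j := by
    by_cases hj : j ∈ S
    · rw [Finset.insert_eq_of_mem hj]
    have h := card_mul_walkStep (G := G) (D := D) z (insert j S)
    rw [Finset.sum_insert hj, Finset.card_insert_of_notMem hj] at h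
    have h1 := (particleStep_insert_self_le hD hV hdeg hz hj).trans (hz.le_walkStep S)
    have h2 : ∑ i ∈ S, particleStep G D z (insert j S) i ≤ S.card * walkStep G D z S := by
      rw [card_mul_walkStep]
      refine Finset.sum_le_sum fun i hi => particleStep_insert_of_ne_le hD hz ?_
      rintro rfl; exact hj hi
    have h3 : (0 : ℝ) < S.card + 1 := by positivity
    push_cast at h
    nlinarith
  sum_insert_le S := by
    have hS := walkStep_nonneg hD (G := G) hz.nonneg S
    rw [← Finset.sum_add_sum_compl S]
    have h0 : ∑ j ∈ S, walkStep G D z (insert j S) = S.card * walkStep G D z S := by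
      rw [← nsmul_eq_mul, ← Finset.sum_const]
      exact Finset.sum_congr rfl fun j hj => by rw [Finset.insert_eq_of_mem hj]
    have h1 : ((S.card : ℝ) + 1) * ∑ j ∈ Sᶜ, walkStep G D z (insert j S) =
        ∑ j ∈ Sᶜ, particleStep G D z (insert j S) j +
          ∑ i ∈ S, ∑ j ∈ Sᶜ, particleStep G D z (insert j S) i := by
      rw [Finset.sum_comm (s := S), ← Finset.sum_add_distrib, Finset.mul_sum]
      refine Finset.sum_congr rfl fun j hj => ?_
      have hj : j ∉ S := by simpa using hj
      have h := card_mul_walkStep (G := G) (D := D) z (insert j S)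
      rw [Finset.sum_insert hj, Finset.card_insert_of_notMem hj] at h
      exact_mod_cast h
    have h2 : ∑ i ∈ S, ∑ j ∈ Sᶜ, particleStep G D z (insert j S) i ≤
        2 * ((S.card : ℝ) + 1) ^ 2 * (S.card * walkStep G D z S) := by
      rw [card_mul_walkStep, Finset.mul_sum]
      exact Finset.sum_le_sum fun i hi => sum_particleStep_insert_le hD hz hi
    have h3 : ∑ j ∈ Sᶜ, particleStep G D z (insert j S) j ≤
        (1 + ((S.card : ℝ) + 1) ^ 2) * walkStep G D z S :=
      (sum_particleStep_insert_self_le hD hV hdeg hz S).trans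
        (mul_le_mul_of_nonneg_left (hz.le_walkStep S) (by positivity))
    have h4 : (0 : ℝ) < S.card + 1 := by positivity
    have h5 : (0 : ℝ) ≤ S.card * walkStep G D z S := by positivity
    rw [h0]
    refine le_of_mul_le_mul_left ?_ h4
    nlinarith
  le_walkStep := walkStep_mono hD hz.le_walkStep

lemma IsSubharmonic.le_one {z : Finset V → ℝ} (hz : IsSubharmonic G D z) (S : Finset V) :
    z S ≤ 1 := by
  induction S using Finset.induction_on with
  | empty => exact hz.empty.le
  | insert a s _ ih => exact (hz.insert_le s a).trans ih

lemma isSubharmonic_indicator (hD : 0 < D) :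
    IsSubharmonic G D (fun S : Finset V => if S = ∅ then (1 : ℝ) else 0) where
  nonneg S := by positivity
  empty := by simp
  insert_le S i := by simp; positivity
  sum_insert_le S := by simp; positivity
  le_walkStep S := by
    split_ifs with h
    · simp [walkStep, h]
    · exact walkStep_nonneg hD (fun S => by positivity) S

lemma continuous_walkStep_apply (S : Finset V) :
    Continuous fun z : Finset V → ℝ => walkStep G D z S := by
  unfold walkStep
  split_ifs
  · exact continuous_const
  · unfold particleStep
    refine Continuous.div_const (continuous_finsetSum _ fun j _ => ?_) _
    refine Continuous.add (by fun_prop) (continuous_const.mul (continuous_finsetSum _ fun i _ => ?_))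
    split_ifs
    · exact continuous_apply _
    · exact continuous_const

/-- The probability that all walkers started from `S` are killed is a fixed point of `walkStep`. -/
lemma exists_isSubharmonic_fixedPoint (hD : 0 < D) (hV : 2 ≤ Fintype.card V)
    (hdeg : ∀ j, ∑ i, (if G.Adj j i then (1 : ℝ) else 0) ≤ D) :
    ∃ z : Finset V → ℝ, IsSubharmonic G D z ∧ walkStep G D z = z := by
  set z₀ : Finset V → ℝ := fun S => if S = ∅ then (1 : ℝ) else 0
  set u : ℕ → Finset V → ℝ := fun m => (walkStep G D)^[m] z₀ with hu
  have hsucc : ∀ m, u (m + 1) = walkStep G D (u m) := fun m => Function.iterate_succ_apply' _ _ _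
  have hsub : ∀ m, IsSubharmonic G D (u m) := by
    intro m
    induction m with
    | zero => exact isSubharmonic_indicator hD
    | succ m ih => rw [hsucc]; exact isSubharmonic_walkStep hD hV hdeg ih
  have hmono : ∀ S, Monotone fun m => u m S := fun S =>
    monotone_nat_of_le_succ fun m => by rw [hsucc]; exact (hsub m).le_walkStep S
  have hbdd : ∀ S, BddAbove (Set.range fun m => u m S) := fun S =>
    ⟨1, by rintro _ ⟨m, rfl⟩; exact (hsub m).le_one S⟩
  set z : Finset V → ℝ := fun S => ⨆ m, u m S
  have hlim : ∀ S, Filter.Tendsto (fun m => u m S) Filter.atTop (nhds (z S)) := fun S =>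
    tendsto_atTop_ciSup (hmono S) (hbdd S)
  have hfix : walkStep G D z = z := by
    funext S
    have h1 : Filter.Tendsto (fun m => walkStep G D (u m) S) Filter.atTop
        (nhds (walkStep G D z S)) :=
      ((continuous_walkStep_apply S).tendsto z).comp (tendsto_pi_nhds.2 hlim)
    have h2 := (hlim S).comp (Filter.tendsto_add_atTop_nat 1)
    refine tendsto_nhds_unique h1 (h2.congr fun m => ?_)
    simp [hsucc]
  refine ⟨z, ⟨fun S => ge_of_tendsto' (hlim S) fun m => (hsub m).nonneg S, ?_, fun S i =>
    le_of_tendsto_of_tendsto' (hlim _) (hlim _) fun m => (hsub m).insert_le S i, fun S =>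
    le_of_tendsto_of_tendsto' (tendsto_finsetSum _ fun j _ => hlim _)
      ((hlim S).const_mul _) fun m => (hsub m).sum_insert_le S, fun S => by rw [hfix]⟩, hfix⟩
  exact tendsto_nhds_unique (hlim ∅) (by simp [(hsub _).empty])

lemma IsSubharmonic.le_insert_of_adj (hD : 1 ≤ D) {z : Finset V → ℝ} (hz : IsSubharmonic G D z)
    (hfix : walkStep G D z = z) {S : Finset V} {i j : V} (hi : i ∈ S) (hij : G.Adj i j) :
    1 / (2 * D * (S.card + 1)) * z S ≤ z (insert j S) := by
  have hD0 : 0 < D := by linarith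
  by_cases hj : j ∈ S
  · rw [Finset.insert_eq_of_mem hj]
    refine mul_le_of_le_one_left (hz.nonneg S) ?_
    rw [div_le_one (by positivity)]
    have : (0 : ℝ) ≤ S.card := by positivity
    nlinarith
  have h := card_mul_walkStep (G := G) (D := D) z (insert j S)
  rw [Finset.sum_insert hj, Finset.card_insert_of_notMem hj, hfix] at h
  have h1 : 0 ≤ ∑ i ∈ S, particleStep G D z (insert j S) i :=
    Finset.sum_nonneg fun i _ => particleStep_nonneg hD0 hz.nonneg _ _
  have h2 : 1 / (2 * D) * z S ≤ particleStep G D z (insert j S) j := by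
    unfold particleStep
    rw [Finset.erase_insert hj]
    have h3 : z S ≤ ∑ k, if G.Adj j k then z (insert k S) else 0 := by
      refine le_trans ?_ (Finset.single_le_sum (f := fun k => if G.Adj j k then z (insert k S) else 0)
        (fun k _ => ?_) (Finset.mem_univ i))
      · simp [hij.symm, Finset.insert_eq_of_mem hi]
      · split_ifs; exacts [hz.nonneg _, le_rfl]
    have h4 := hz.nonneg S
    have : 0 ≤ 1 / (Fintype.card V : ℝ) * z S := by positivity
    have : 1 / (2 * D) * z S ≤ 1 / (2 * D) * ∑ k, if G.Adj j k then z (insert k S) else 0 := by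
      gcongr
    linarith
  have h5 : (0 : ℝ) < S.card + 1 := by positivity
  refine le_of_mul_le_mul_left ?_ h5
  push_cast at h
  calc ((S.card : ℝ) + 1) * (1 / (2 * D * (S.card + 1)) * z S) = 1 / (2 * D) * z S := by
        field_simp
    _ ≤ _ := by linarith

end KilledWalk

section InclusionExclusion

variable {V : Type*} [DecidableEq V]

/-- The inclusion–exclusion value of the event that all of `S` and none of `T` is chosen. -/
noncomputable def inclExcl (x : Finset V → ℝ) (S T : Finset V) : ℝ :=
  ∑ J ∈ T.powerset, (-1 : ℝ) ^ J.card * x (S ∪ J)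

lemma inclExcl_insert_right (x : Finset V → ℝ) (S : Finset V) {T : Finset V} {t : V} (ht : t ∉ T) :
    inclExcl x S (insert t T) = inclExcl x S T - inclExcl x (insert t S) T := by
  unfold inclExcl
  rw [Finset.sum_powerset_insert ht, sub_eq_add_neg, ← Finset.sum_neg_distrib]
  congr 1
  refine Finset.sum_congr rfl fun J hJ => ?_
  have htJ : t ∉ J := fun h => ht (Finset.mem_powerset.1 hJ h)
  rw [Finset.card_insert_of_notMem htJ, pow_succ, Finset.union_insert, Finset.insert_union]
  ring

lemma inclExcl_eq_zero (x : Finset V → ℝ) {S T : Finset V} {t : V} (hS : t ∈ S) (hT : t ∈ T) :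
    inclExcl x S T = 0 := by
  rw [← Finset.insert_erase hT, inclExcl_insert_right x S (Finset.notMem_erase t T),
    Finset.insert_eq_of_mem hS, sub_self]

lemma inclExcl_bounds {x : Finset V → ℝ} {ε : ℝ} (hε : 0 ≤ ε) (hx : ∀ S, 0 ≤ x S)
    (hins : ∀ S i, i ∉ S → x (insert i S) ≤ ε * x S) (T : Finset V) :
    ε * T.card ≤ 1 → ∀ S, Disjoint S T →
      (1 - ε * T.card) * x S ≤ inclExcl x S T ∧ inclExcl x S T ≤ x S := by
  induction T using Finset.induction_on with
  | empty => intro _ S _; simp [inclExcl]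
  | insert t T ht ih =>
    intro hT S hd
    rw [Finset.card_insert_of_notMem ht] at hT ⊢
    push_cast at hT ⊢
    rw [Finset.disjoint_insert_right] at hd
    have hT' : ε * T.card ≤ 1 := by linarith
    have h1 := ih hT' S hd.2
    have h2 := ih hT' (insert t S) (Finset.disjoint_insert_left.2 ⟨ht, hd.2⟩)
    have h3 := hins S t hd.1
    have h4 : 0 ≤ (1 - ε * T.card) * x (insert t S) :=
      mul_nonneg (by linarith) (hx _)
    rw [inclExcl_insert_right x S ht]
    constructor <;> linarith

lemma inclExcl_mem_Icc {x : Finset V → ℝ} {ε : ℝ} (hε : 0 ≤ ε) (hx : ∀ S, 0 ≤ x S)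
    (hins : ∀ S i, i ∉ S → x (insert i S) ≤ ε * x S) {T : Finset V} (hT : ε * T.card ≤ 1)
    (S : Finset V) : inclExcl x S T ∈ Set.Icc 0 (x S) := by
  by_cases hd : Disjoint S T
  · have h := inclExcl_bounds hε hx hins T hT S hd
    exact ⟨(mul_nonneg (by linarith) (hx S)).trans h.1, h.2⟩
  · obtain ⟨t, hS, hT⟩ := Finset.not_disjoint_iff.1 hd
    rw [inclExcl_eq_zero x hS hT]
    exact ⟨le_rfl, hx S⟩

end InclusionExclusion

section PseudoDistribution

variable {V : Type*}

/-- The pseudo-distribution built from `z`: square roots, damped by `ε` per vertex. -/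
noncomputable def dampedSqrt (ε : ℝ) (z : Finset V → ℝ) (S : Finset V) : ℝ :=
  ε ^ S.card * √(z S)

variable {z : Finset V → ℝ} {ε : ℝ}

lemma dampedSqrt_nonneg (hε : 0 ≤ ε) (S : Finset V) : 0 ≤ dampedSqrt ε z S :=
  mul_nonneg (pow_nonneg hε _) (Real.sqrt_nonneg _)

lemma dampedSqrt_insert [DecidableEq V] {S : Finset V} {i : V} (hi : i ∉ S) :
    dampedSqrt ε z (insert i S) = ε ^ S.card * (ε * √(z (insert i S))) := by
  rw [dampedSqrt, Finset.card_insert_of_notMem hi, pow_succ, mul_assoc]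

variable [Fintype V] [DecidableEq V] {G : SimpleGraph V} [DecidableRel G.Adj] {D : ℝ}

lemma dampedSqrt_insert_le (hε : 0 ≤ ε) (hz : IsSubharmonic G D z) {S : Finset V} {i : V}
    (hi : i ∉ S) : dampedSqrt ε z (insert i S) ≤ ε * dampedSqrt ε z S := by
  rw [dampedSqrt_insert hi, dampedSqrt, mul_left_comm]
  gcongr
  exact hz.insert_le S i

lemma dampedSqrt_le_one (hε : 0 ≤ ε) (hε1 : ε ≤ 1) (hz : IsSubharmonic G D z) (S : Finset V) :
    dampedSqrt ε z S ≤ 1 :=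
  mul_le_one₀ (pow_le_one₀ hε hε1) (Real.sqrt_nonneg _) (Real.sqrt_le_one.2 (hz.le_one S))

lemma sum_dampedSqrt_insert_le (hε : 0 ≤ ε) (hz : IsSubharmonic G D z) (S : Finset V) :
    ∑ i, dampedSqrt ε z (insert i S) ≤
      (S.card + 2 * ε * (S.card + 1) * √(Fintype.card V)) * dampedSqrt ε z S := by
  have hsqrt : ∑ i, √(z (insert i S)) ≤ 2 * (S.card + 1) * √(Fintype.card V) * √(z S) := by
    refine le_of_sq_le_sq ?_ (by positivity)
    calc (∑ i, √(z (insert i S))) ^ 2 ≤ Fintype.card V * ∑ i, √(z (insert i S)) ^ 2 := by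
          simpa using sq_sum_le_card_mul_sum_sq (s := Finset.univ) (f := fun i => √(z (insert i S)))
      _ = Fintype.card V * ∑ i, z (insert i S) := by
          simp_rw [Real.sq_sqrt (hz.nonneg _)]
      _ ≤ Fintype.card V * (2 * ((S.card : ℝ) + 1) ^ 2 * z S) := by
          gcongr; exact hz.sum_insert_le S
      _ ≤ Fintype.card V * (4 * ((S.card : ℝ) + 1) ^ 2 * z S) := by
          have := hz.nonneg S
          gcongr; norm_num
      _ = _ := by
          rw [mul_pow, mul_pow, mul_pow, Real.sq_sqrt (hz.nonneg _), Real.sq_sqrt (by positivity)]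
          ring
  calc ∑ i, dampedSqrt ε z (insert i S)
      ≤ ∑ i, ((if i ∈ S then dampedSqrt ε z S else 0) + ε ^ S.card * (ε * √(z (insert i S)))) := by
        refine Finset.sum_le_sum fun i _ => ?_
        split_ifs with hi
        · rw [Finset.insert_eq_of_mem hi]
          have : 0 ≤ ε ^ S.card * (ε * √(z S)) := by positivity
          linarith
        · rw [dampedSqrt_insert hi, zero_add]
    _ = S.card * dampedSqrt ε z S + ε ^ S.card * (ε * ∑ i, √(z (insert i S))) := by
        rw [Finset.sum_add_distrib, ← Finset.mul_sum, ← Finset.mul_sum]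
        simp
    _ ≤ S.card * dampedSqrt ε z S +
          ε ^ S.card * (ε * (2 * (S.card + 1) * √(Fintype.card V) * √(z S))) := by
        gcongr
    _ = _ := by rw [dampedSqrt]; ring

lemma le_dampedSqrt_insert (hε : 0 ≤ ε) (hε1 : ε ≤ 1) (hD : 1 ≤ D) (hz : IsSubharmonic G D z)
    (hfix : walkStep G D z = z) {S : Finset V} {i j : V} (hi : i ∈ S) (hij : G.Adj i j) :
    ε * √(1 / (2 * D * (S.card + 1))) * dampedSqrt ε z S ≤ dampedSqrt ε z (insert j S) := by
  have h : √(1 / (2 * D * (S.card + 1))) * √(z S) ≤ √(z (insert j S)) := by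
    rw [← Real.sqrt_mul (by positivity)]
    exact Real.sqrt_le_sqrt (hz.le_insert_of_adj hD hfix hi hij)
  calc ε * √(1 / (2 * D * (S.card + 1))) * dampedSqrt ε z S
      = ε ^ (S.card + 1) * (√(1 / (2 * D * (S.card + 1))) * √(z S)) := by
        rw [dampedSqrt]; ring
    _ ≤ ε ^ (insert j S).card * √(z (insert j S)) := by
        gcongr ?_ * ?_
        · exact pow_le_pow_of_le_one hε hε1 (Finset.card_insert_le _ _)

end PseudoDistribution

open Classical in
lemma saFeasible_of_degree_bounds {n : ℕ} (hn : 2 ≤ n) {G : SimpleGraph (Fin n)} {L : ℕ}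
    (hL : 3 ≤ L) {D k m : ℝ} (hD : 1 ≤ D) (hm : 0 ≤ m)
    (hmax : ∀ j, ∑ i, (if G.Adj j i then (1 : ℝ) else 0) ≤ D)
    (hmin : ∀ j, m + L ≤ ∑ i, (if G.Adj j i then (1 : ℝ) else 0))
    (hk : L + √n / 3 ≤ 7 / 8 * k) :
    SAFeasible n G L k (m * (7 / 8) * (1 / (8 * L) * √(1 / (2 * D * (L + 2))))) := by
  obtain ⟨z, hz, hfix⟩ := exists_isSubharmonic_fixedPoint (by linarith) (by simpa using hn) hmax
  have hL' : (3 : ℝ) ≤ L := by exact_mod_cast hL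
  obtain ⟨ε, hεdef⟩ : ∃ ε : ℝ, ε = 1 / (8 * L) := ⟨_, rfl⟩
  have hεL : ε * L = 1 / 8 := by rw [hεdef]; field_simp
  have hε : 0 ≤ ε := by rw [hεdef]; positivity
  have hε1 : ε ≤ 1 := by nlinarith
  rw [← hεdef]
  have hx := dampedSqrt_nonneg (z := z) hε
  have hins := fun S i hi => dampedSqrt_insert_le (S := S) (i := i) hε hz hi
  refine ⟨dampedSqrt ε z, by simp [dampedSqrt, hz.empty], fun S T hd hST => ?_⟩
  have hST' : (S.card : ℝ) + T.card ≤ L := by exact_mod_cast hST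
  have hS0 : (0 : ℝ) ≤ S.card := by positivity
  have hT0 : (0 : ℝ) ≤ T.card := by positivity
  have hεT : ε * T.card ≤ 1 / 8 := by nlinarith
  have hIcc := fun A => inclExcl_mem_Icc hε hx hins (T := T) (by linarith) A
  have hlow : ∀ A, Disjoint A T → 7 / 8 * dampedSqrt ε z A ≤ inclExcl (dampedSqrt ε z) A T := by
    intro A hA
    have h1 := (inclExcl_bounds hε hx hins T (by linarith) A hA).1
    have h2 := hx A
    nlinarith
  simp_rw [← Finset.insert_union]
  refine ⟨?_, fun i => ?_, (hIcc S).1, (hIcc S).2.trans (dampedSqrt_le_one hε hε1 hz S)⟩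
  · have hk0 : 0 ≤ k := by have := Real.sqrt_nonneg n; linarith
    calc ∑ i, inclExcl (dampedSqrt ε z) (insert i S) T
        ≤ ∑ i, dampedSqrt ε z (insert i S) := Finset.sum_le_sum fun i _ => (hIcc _).2
      _ ≤ (S.card + 2 * ε * (S.card + 1) * √n) * dampedSqrt ε z S := by
        simpa using sum_dampedSqrt_insert_le hε hz S
      _ ≤ (L + 1 / 3 * √n) * dampedSqrt ε z S := by
        have := hx S
        gcongr
        · linarith
        · nlinarith
      _ ≤ (7 / 8 * k) * dampedSqrt ε z S := by
        have := hx S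
        gcongr
        linarith
      _ = k * (7 / 8 * dampedSqrt ε z S) := by ring
      _ ≤ k * inclExcl (dampedSqrt ε z) S T := by
        gcongr
        exact hlow S hd
  · change _ * inclExcl (dampedSqrt ε z) (insert i S) T ≤
      ∑ j, if G.Adj i j then inclExcl (dampedSqrt ε z) (insert j (insert i S)) T else 0
    by_cases hiT : i ∈ T
    · rw [inclExcl_eq_zero _ (Finset.mem_insert_self i S) hiT, mul_zero]
      exact Finset.sum_nonneg fun j _ => by split_ifs; exacts [(hIcc _).1, le_rfl]
    have hd' : Disjoint (insert i S) T := Finset.disjoint_insert_left.2 ⟨hiT, hd⟩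
    obtain ⟨r, hr⟩ : ∃ r, r = ε * √(1 / (2 * D * (L + 2))) * dampedSqrt ε z (insert i S) :=
      ⟨_, rfl⟩
    have hr0 : 0 ≤ r := by rw [hr]; have := hx (insert i S); positivity
    have hcard : ((insert i S).card : ℝ) + 1 ≤ L + 2 := by
      have : ((insert i S).card : ℝ) ≤ S.card + 1 := by exact_mod_cast Finset.card_insert_le i S
      linarith
    have hterm : ∀ j, (if G.Adj i j then 7 / 8 * r else 0) - (if j ∈ T then 7 / 8 * r else 0) ≤
        if G.Adj i j then inclExcl (dampedSqrt ε z) (insert j (insert i S)) T else 0 := by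
      intro j
      by_cases hij : G.Adj i j
      · rw [if_pos hij, if_pos hij]
        by_cases hj : j ∈ T
        · rw [if_pos hj, sub_self]
          exact (hIcc _).1
        · rw [if_neg hj, sub_zero]
          refine le_trans ?_ (hlow _ (Finset.disjoint_insert_left.2 ⟨hj, hd'⟩))
          gcongr
          refine le_trans ?_ (le_dampedSqrt_insert hε hε1 hD hz hfix (Finset.mem_insert_self i S) hij)
          rw [hr]
          have := hx (insert i S)
          gcongr
      · rw [if_neg hij, if_neg hij]
        split_ifs <;> linarith
    calc _ ≤ m * (7 / 8) * (ε * √(1 / (2 * D * (L + 2)))) * dampedSqrt ε z (insert i S) := by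
          gcongr
          exact (hIcc _).2
      _ = m * (7 / 8 * r) := by rw [hr]; ring
      _ ≤ (∑ j, (if G.Adj i j then (1 : ℝ) else 0) - T.card) * (7 / 8 * r) := by
        gcongr
        have := hmin i
        linarith
      _ = ∑ j, ((if G.Adj i j then 7 / 8 * r else 0) - (if j ∈ T then 7 / 8 * r else 0)) := by
        rw [Finset.sum_sub_distrib, sub_mul, Finset.sum_mul]
        simp
      _ ≤ _ := Finset.sum_le_sum fun j _ => hterm j

section RandomSubset

variable {α ι : Type*} [Fintype α] [DecidableEq α]

lemma sum_bernoulli_mul_exp (p θ : ℝ) (B : Finset α) :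
    ∑ X : Finset α, p ^ X.card * (1 - p) ^ Xᶜ.card * Real.exp (θ * (X ∩ B).card) =
      (1 + (Real.exp θ - 1) * p) ^ B.card := by
  have h := Finset.prod_add (fun a : α => if a ∈ B then p * Real.exp θ else p)
    (fun _ => 1 - p) Finset.univ
  have h1 : ∏ a : α, ((if a ∈ B then p * Real.exp θ else p) + (1 - p)) =
      (1 + (Real.exp θ - 1) * p) ^ B.card := by
    rw [← Finset.prod_const, ← Finset.prod_subset (Finset.subset_univ B)]
    · refine Finset.prod_congr rfl fun a ha => ?_
      rw [if_pos ha]; ring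
    · intro a _ ha
      rw [if_neg ha]; ring
  rw [← h1, h, Finset.powerset_univ]
  refine Finset.sum_congr rfl fun X _ => ?_
  rw [Finset.prod_const, ← Finset.compl_eq_univ_sdiff, Finset.prod_ite, Finset.prod_const,
    Finset.prod_const, Finset.filter_mem_eq_inter, mul_pow, mul_comm θ, Real.exp_nat_mul]
  have : X.card = (X ∩ B).card + (X.filter fun a => a ∉ B).card := by
    rw [← Finset.filter_mem_eq_inter, Finset.card_filter_add_card_filter_not]
  rw [this, pow_add]
  ring

/-- Chernoff bounds and the union bound for a random subset of `α`. -/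
lemma exists_finset_forall_mul_card_inter_lt [Fintype ι] {p : ℝ} (hp0 : 0 ≤ p) (hp1 : p ≤ 1)
    (θ τ : ι → ℝ) (B : ι → Finset α)
    (h : ∑ b, Real.exp (-τ b + (Real.exp (θ b) - 1) * p * (B b).card) < 1) :
    ∃ X : Finset α, ∀ b, θ b * (X ∩ B b).card < τ b := by
  by_contra! hcon
  have hw : ∀ X : Finset α, 0 ≤ p ^ X.card * (1 - p) ^ Xᶜ.card := fun X =>
    mul_nonneg (pow_nonneg hp0 _) (pow_nonneg (by linarith) _)
  have htotal : ∑ X : Finset α, p ^ X.card * (1 - p) ^ Xᶜ.card = 1 := by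
    simpa using sum_bernoulli_mul_exp p 0 (∅ : Finset α)
  refine h.not_ge ?_
  calc (1 : ℝ) = ∑ X : Finset α, p ^ X.card * (1 - p) ^ Xᶜ.card := htotal.symm
    _ ≤ ∑ X : Finset α, p ^ X.card * (1 - p) ^ Xᶜ.card *
          ∑ b, Real.exp (-τ b + θ b * (X ∩ B b).card) := by
        refine Finset.sum_le_sum fun X _ => le_mul_of_one_le_right (hw X) ?_
        obtain ⟨b, hb⟩ := hcon X
        refine le_trans (Real.one_le_exp (by linarith)) (Finset.single_le_sum
          (f := fun b => Real.exp (-τ b + θ b * (X ∩ B b).card)) (fun b _ => (Real.exp_pos _).le)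
          (Finset.mem_univ b))
    _ = ∑ b, Real.exp (-τ b) *
          ∑ X : Finset α, p ^ X.card * (1 - p) ^ Xᶜ.card * Real.exp (θ b * (X ∩ B b).card) := by
        simp_rw [Finset.mul_sum]
        rw [Finset.sum_comm]
        refine Finset.sum_congr rfl fun b _ => Finset.sum_congr rfl fun X _ => ?_
        rw [Real.exp_add]; ring
    _ ≤ _ := by
        refine Finset.sum_le_sum fun b _ => ?_
        rw [sum_bernoulli_mul_exp, Real.exp_add]
        gcongr
        rw [mul_comm _ ((B b).card : ℝ), Real.exp_nat_mul]
        refine pow_le_pow_left₀ ?_ (by linarith [Real.add_one_le_exp ((Real.exp (θ b) - 1) * p)]) _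
        have := (Real.exp_pos (θ b)).le
        nlinarith

end RandomSubset

section RandomGraph

lemma card_inter_product {V : Type*} [DecidableEq V] (X : Finset (V × V)) (A B : Finset V) :
    ((X ∩ A ×ˢ B).card : ℝ) = ∑ i ∈ A, ∑ j ∈ B, if (i, j) ∈ X then (1 : ℝ) else 0 := by
  rw [← Finset.sum_product' A B fun i j => if (i, j) ∈ X then (1 : ℝ) else 0, Finset.inter_comm,
    ← Finset.filter_mem_eq_inter, Finset.card_filter]
  push_cast
  rfl

/-- Tails for the rows, the columns and the `k × k` principal blocks of a random subset of
`Fin n × Fin n` of density `log n / √n`. -/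
lemma exists_finset_card_inter_bounds {n : ℕ} (hn : 8 ≤ √n) (hlog : 1 ≤ Real.log n)
    (hlog' : Real.log n ≤ √n) :
    ∃ X : Finset (Fin n × Fin n),
      (∀ i, Real.log n * √n / 4 ≤ (X ∩ {i} ×ˢ Finset.univ).card) ∧
      (∀ i, ((X ∩ {i} ×ˢ Finset.univ).card : ℝ) ≤ 5 / 2 * (Real.log n * √n)) ∧
      (∀ i, ((X ∩ Finset.univ ×ˢ {i}).card : ℝ) ≤ 5 / 2 * (Real.log n * √n)) ∧
      ∀ S : Finset (Fin n), S.card = Nat.sqrt n →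
        ((X ∩ S ×ˢ S).card : ℝ) ≤ 4 * Real.log n * Nat.sqrt n := by
  obtain ⟨ℓ, hℓ⟩ : ∃ ℓ, ℓ = Real.log n := ⟨_, rfl⟩
  obtain ⟨N, hN⟩ : ∃ N, N = √(n : ℝ) := ⟨_, rfl⟩
  obtain ⟨k, hk⟩ : ∃ k, k = Nat.sqrt n := ⟨_, rfl⟩
  rw [← hℓ] at hlog hlog' ⊢
  rw [← hN] at hn hlog' ⊢
  rw [← hk]
  have hnN : (n : ℝ) = N * N := by rw [hN, Real.mul_self_sqrt (by positivity)]
  have hn0 : (0 : ℝ) < n := by rw [hnN]; nlinarith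
  have hkN : (k : ℝ) ≤ N := by
    rw [hk, hN]; exact Real.nat_sqrt_le_real_sqrt
  have hk1 : (1 : ℝ) ≤ k := by
    have : 0 < k := by rw [hk]; exact Nat.sqrt_pos.2 (by exact_mod_cast hn0)
    exact_mod_cast this
  have hp : ℓ / N * n = ℓ * N := by rw [hnN]; field_simp
  have hp0 : 0 ≤ ℓ / N := by positivity
  have hpk : ℓ / N * k ≤ ℓ := by
    rw [div_mul_eq_mul_div, div_le_iff₀ (by linarith)]; gcongr
  have hP : 8 * ℓ ≤ ℓ * N := by nlinarith
  have hexp : Real.exp ℓ = n := by rw [hℓ, Real.exp_log hn0]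
  have he : Real.exp 1 - 1 ≤ 2 := by linarith [Real.exp_one_lt_d9]
  have he' : Real.exp (-1) - 1 ≤ -(1 / 2) := by
    have : Real.exp (-1) ≤ 1 / 2 := by
      rw [Real.exp_neg, ← one_div]
      gcongr
      linarith [Real.exp_one_gt_d9]
    linarith
  have hsum : ∀ E : ℝ, E ≤ -(2 * ℓ) → n * Real.exp E ≤ 1 / n := by
    intro E hE
    calc (n : ℝ) * Real.exp E ≤ n * Real.exp (-(2 * ℓ)) := by gcongr
      _ = 1 / n := by rw [Real.exp_neg, two_mul, Real.exp_add, hexp]; field_simp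
  obtain ⟨X, hX⟩ := exists_finset_forall_mul_card_inter_lt
    (ι := Fin n ⊕ Fin n ⊕ Fin n ⊕ {S : Finset (Fin n) // S.card = k}) hp0
    (show ℓ / N ≤ 1 from div_le_one_of_le₀ (by linarith) (by linarith))
    (Sum.elim (fun _ => -1) (fun _ => 1))
    (Sum.elim (fun _ => -(ℓ * N / 4)) (Sum.elim (fun _ => 5 / 2 * (ℓ * N))
      (Sum.elim (fun _ => 5 / 2 * (ℓ * N)) (fun _ => 4 * ℓ * k))))
    (Sum.elim (fun i => {i} ×ˢ Finset.univ) (Sum.elim (fun i => {i} ×ˢ Finset.univ)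
      (Sum.elim (fun i => Finset.univ ×ˢ {i}) (fun S => S.1 ×ˢ S.1)))) (by
    have hrow : n * Real.exp (- -(ℓ * N / 4) + (Real.exp (-1) - 1) * (ℓ / N) * n) ≤ 1 / n := by
      apply hsum
      rw [mul_assoc, hp]
      nlinarith
    have hrow' : n * Real.exp (-(5 / 2 * (ℓ * N)) + (Real.exp 1 - 1) * (ℓ / N) * n) ≤ 1 / n := by
      apply hsum
      rw [mul_assoc, hp]
      nlinarith
    have hset : ∑ S : {S : Finset (Fin n) // S.card = k},
        Real.exp (-(4 * ℓ * k) + (Real.exp 1 - 1) * (ℓ / N) * ((S : Finset (Fin n)).card *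
          (S : Finset (Fin n)).card : ℝ)) ≤ 1 / n := by
      have hcard : ((Fintype.card {S : Finset (Fin n) // S.card = k} : ℕ) : ℝ) ≤
          Real.exp (ℓ * k) := by
        rw [Fintype.card_finset_len, Fintype.card_fin, mul_comm ℓ, Real.exp_nat_mul, hexp]
        exact_mod_cast Nat.choose_le_pow n k
      calc _ ≤ ∑ S : {S : Finset (Fin n) // S.card = k}, Real.exp (-(2 * ℓ * k)) := by
            refine Finset.sum_le_sum fun S _ => Real.exp_le_exp.2 ?_
            rw [S.2]
            have h1 : (Real.exp 1 - 1) * (ℓ / N * k * k) ≤ 2 * (ℓ * k) := by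
              gcongr
            linarith
        _ = Fintype.card {S : Finset (Fin n) // S.card = k} * Real.exp (-(2 * ℓ * k)) := by simp
        _ ≤ Real.exp (ℓ * k) * Real.exp (-(2 * ℓ * k)) := by gcongr
        _ = Real.exp (-(ℓ * k)) := by rw [← Real.exp_add]; ring_nf
        _ ≤ Real.exp (-ℓ) := by
            apply Real.exp_le_exp.2; nlinarith
        _ = 1 / n := by rw [Real.exp_neg, hexp, one_div]
    have hlast : 4 * (1 / (n : ℝ)) < 1 := by
      rw [mul_one_div, div_lt_one hn0]; nlinarith
    simp only [Fintype.sum_sum_type, Sum.elim_inl, Sum.elim_inr, Finset.card_product,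
      Finset.card_singleton, Finset.card_univ, Fintype.card_fin, one_mul, mul_one,
      Finset.sum_const, nsmul_eq_mul, Nat.cast_mul]
    linarith)
  refine ⟨X, fun i => ?_, fun i => ?_, fun i => ?_, fun S hS => ?_⟩
  · have := hX (Sum.inl i)
    simp only [Sum.elim_inl] at this
    linarith
  · have := hX (Sum.inr (Sum.inl i))
    simp only [Sum.elim_inl, Sum.elim_inr] at this
    linarith
  · have := hX (Sum.inr (Sum.inr (Sum.inl i)))
    simp only [Sum.elim_inl, Sum.elim_inr] at this
    linarith
  · have := hX (Sum.inr (Sum.inr (Sum.inr ⟨S, hS⟩)))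
    simp only [Sum.elim_inr] at this
    linarith

open Classical in
lemma exists_graph_degree_bounds {n : ℕ} (hn : 8 ≤ √n) (hlog : 1 ≤ Real.log n)
    (hlog' : Real.log n ≤ √n) :
    ∃ G : SimpleGraph (Fin n),
      (∀ i, Real.log n * √n / 4 - 1 ≤ ∑ j, if G.Adj i j then (1 : ℝ) else 0) ∧
      (∀ i, (∑ j, if G.Adj i j then (1 : ℝ) else 0) ≤ 5 * (Real.log n * √n)) ∧
      ∀ S : Finset (Fin n), S.card = Nat.sqrt n →
        (∑ i ∈ S, ∑ j ∈ S, if G.Adj i j then (1 : ℝ) else 0) ≤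
          8 * Real.log n * Nat.sqrt n := by
  obtain ⟨X, hlow, hrow, hcol, hset⟩ := exists_finset_card_inter_bounds hn hlog hlog'
  simp_rw [card_inter_product, Finset.sum_singleton] at hlow hrow hcol hset
  obtain ⟨G, hG⟩ : ∃ G : SimpleGraph (Fin n), ∀ i j, G.Adj i j ↔
      i ≠ j ∧ ((i, j) ∈ X ∨ (j, i) ∈ X) := ⟨SimpleGraph.fromRel fun i j => (i, j) ∈ X, by simp⟩
  have hle : ∀ i j, (if G.Adj i j then (1 : ℝ) else 0) ≤
      (if (i, j) ∈ X then 1 else 0) + if (j, i) ∈ X then 1 else 0 := by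
    intro i j
    have := hG i j
    split_ifs <;> grind
  have hge : ∀ i j, (if (i, j) ∈ X then (1 : ℝ) else 0) - (if i = j then 1 else 0) ≤
      if G.Adj i j then 1 else 0 := by
    intro i j
    have := hG i j
    split_ifs <;> grind
  refine ⟨G, fun i => ?_, fun i => ?_, fun S hS => ?_⟩
  · refine le_trans ?_ (Finset.sum_le_sum fun j _ => hge i j)
    rw [Finset.sum_sub_distrib]
    simpa using hlow i
  · refine (Finset.sum_le_sum fun j _ => hle i j).trans ?_
    rw [Finset.sum_add_distrib]
    linarith [hrow i, hcol i]
  · refine (Finset.sum_le_sum fun i _ => Finset.sum_le_sum fun j _ => hle i j).trans ?_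
    simp_rw [Finset.sum_add_distrib]
    rw [Finset.sum_comm (f := fun i j => if (j, i) ∈ X then (1 : ℝ) else 0)]
    linarith [hset S hS]

end RandomGraph

open Classical in
/-- There are absolute constants `c, c' > 0` such that for all large
`n` and every `L` with `3 ≤ L ≤ log n / (10 log log n)`, there is a graph `G` on `n`
vertices with `k = ⌊√n⌋` such that (i) `SA_L` is feasible with value
`d ≥ c n^{1/4} / L`, and (ii) every induced subgraph on `k` vertices has average degree
at most `c' (log n)²` (i.e. the sum of its degrees is at most `c' (log n)² k`). -/
theorem sherali_adams_integrality_gap :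
    ∃ c c' : ℝ, 0 < c ∧ 0 < c' ∧ ∃ n₀ : ℕ, ∀ n : ℕ, n₀ ≤ n → ∀ L : ℕ,
      3 ≤ L → (L : ℝ) ≤ Real.log n / (10 * Real.log (Real.log n)) →
      ∃ G : SimpleGraph (Fin n),
        (∃ d : ℝ, c * (n : ℝ) ^ ((1 : ℝ) / 4) / L ≤ d ∧
          SAFeasible n G L (Nat.sqrt n : ℝ) d) ∧
        (∀ S : Finset (Fin n), S.card = Nat.sqrt n →
          (∑ i ∈ S, ∑ j ∈ S, if G.Adj i j then (1 : ℝ) else 0) ≤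
            c' * (Real.log n) ^ 2 * (Nat.sqrt n : ℝ)) := by
  refine ⟨1 / 400, 8, by norm_num, by norm_num, 40 ^ 4, fun n hn L hL hLlog => ?_⟩
  have hn' : (40 : ℝ) ^ 4 ≤ n := by exact_mod_cast hn
  have hn0 : (0 : ℝ) < n := lt_of_lt_of_le (by norm_num) hn'
  have hL' : (3 : ℝ) ≤ L := by exact_mod_cast hL
  obtain ⟨q, hq⟩ : ∃ q, q = (n : ℝ) ^ ((1 : ℝ) / 4) := ⟨_, rfl⟩
  have hq0 : 0 < q := by rw [hq]; positivity
  have hq4 : q ^ 4 = n := by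
    rw [hq, ← Real.rpow_natCast, ← Real.rpow_mul hn0.le]; norm_num
  have hq40 : 40 ≤ q := le_of_pow_le_pow_left₀ (by norm_num) hq0.le (hn'.trans_eq hq4.symm)
  have hN : √(n : ℝ) = q ^ 2 := by
    rw [← hq4, show q ^ 4 = (q ^ 2) ^ 2 by ring, Real.sqrt_sq (by positivity)]
  obtain ⟨ℓ, hℓ⟩ : ∃ ℓ, ℓ = Real.log n := ⟨_, rfl⟩
  have hℓq : ℓ = 4 * Real.log q := by rw [hℓ, ← hq4, Real.log_pow]; norm_num
  have hℓN : ℓ ≤ q ^ 2 / 10 := by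
    have := Real.log_le_sub_one_of_pos hq0
    nlinarith
  have hlog2 := Real.log_two_gt_d9
  have hℓ2 : 2 ≤ ℓ := by
    have := Real.log_le_log (x := 2) (by norm_num) (show 2 ≤ q by linarith)
    linarith
  have hLℓ : (L : ℝ) ≤ ℓ := by
    have h := Real.log_le_log (by norm_num) hℓ2
    rw [← hℓ, le_div_iff₀ (by linarith)] at hLlog
    nlinarith
  obtain ⟨G, hmin, hmax, hset⟩ := exists_graph_degree_bounds (n := n) (by rw [hN]; nlinarith)
    (by rw [← hℓ]; linarith) (by rw [hN, ← hℓ]; linarith)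
  rw [← hℓ, hN] at hmin hmax
  rw [← hℓ] at hset ⊢
  rw [← hq]
  obtain ⟨P, hP⟩ : ∃ P, P = ℓ * q ^ 2 := ⟨_, rfl⟩
  have hPℓ : 1600 * ℓ ≤ P := by rw [hP]; nlinarith
  rw [← hP] at hmin hmax
  refine ⟨G, ⟨_, ?_, saFeasible_of_degree_bounds (D := 5 * P) (m := P / 8) ?_ hL (by linarith)
    (by linarith) hmax (fun j => by linarith [hmin j]) ?_⟩, fun S hS => (hset S hS).trans ?_⟩
  · have hsqrt : q / (5 * P) ≤ √(1 / (2 * (5 * P) * (L + 2))) := by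
      apply Real.le_sqrt_of_sq_le
      have hP0 : 0 < P := by linarith
      rw [div_pow, div_le_div_iff₀ (by positivity) (by positivity), one_mul]
      calc q ^ 2 * (2 * (5 * P) * (L + 2)) = P * q ^ 2 * (10 * (L + 2)) := by ring
        _ ≤ P * q ^ 2 * (25 * ℓ) :=
          mul_le_mul_of_nonneg_left (by linarith) (by positivity)
        _ = 25 * P * (ℓ * q ^ 2) := by ring
        _ = (5 * P) ^ 2 := by rw [← hP]; ring
    have hP0 : 0 < P := by linarith
    calc 1 / 400 * q / L ≤ 7 / 2560 * (q / L) := by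
          rw [mul_div_assoc]
          exact mul_le_mul_of_nonneg_right (by norm_num) (by positivity)
      _ = P / 8 * (7 / 8) * (1 / (8 * L) * (q / (5 * P))) := by field_simp; norm_num
      _ ≤ _ := by gcongr
  · exact le_trans (by norm_num) hn
  · have hk : √(n : ℝ) - 1 ≤ Nat.sqrt n := by
      have := Real.real_sqrt_le_nat_sqrt_succ (a := n)
      linarith
    rw [hN] at hk ⊢
    nlinarith
  · gcongr
    nlinarith
end

section
/- Let V be a finite set, let L ≥ 1 be a real number, and let x : (finite subsets of V) → ℝ be nonnegative and satisfy x_{S∪{i}} ≤ x_S/L for every finite S ⊆ V and every i ∈ V \ S. Then for all disjoint finite subsets S, T ⊆ V with |T| ≤ L/2, one has x_S/2 ≤ Σ_{J⊆T} (−1)^{|J|} x_{S∪J} ≤ x_S. -/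
/-- The alternating sum over `insert i T` is a difference of two alternating sums over `T`. -/
theorem alternating_sum_powerset_insert {V : Type*} [DecidableEq V] (x : Finset V → ℝ)
    (S : Finset V) {T : Finset V} {i : V} (hi : i ∉ T) :
    ∑ J ∈ (insert i T).powerset, (-1 : ℝ) ^ J.card * x (S ∪ J) =
      ∑ J ∈ T.powerset, (-1 : ℝ) ^ J.card * x (S ∪ J) -
        ∑ J ∈ T.powerset, (-1 : ℝ) ^ J.card * x (insert i S ∪ J) := by
  rw [Finset.sum_powerset_insert hi, sub_eq_add_neg, ← Finset.sum_neg_distrib]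
  congr 1
  refine Finset.sum_congr rfl fun J hJ => ?_
  have hiJ : i ∉ J := fun h => hi (Finset.mem_powerset.mp hJ h)
  rw [Finset.card_insert_of_notMem hiJ, Finset.union_insert, Finset.insert_union, pow_succ]
  ring

theorem alternating_sum_powerset_bounds {V : Type*} [DecidableEq V] {L : ℝ} (hL : 0 < L)
    {x : Finset V → ℝ} (hnn : ∀ S : Finset V, 0 ≤ x S)
    (hdec : ∀ (S : Finset V), ∀ i ∉ S, x (insert i S) ≤ x S / L)
    {S T : Finset V} (hST : Disjoint S T) (hT : (T.card : ℝ) ≤ L) :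
    x S * (1 - T.card / L) ≤ ∑ J ∈ T.powerset, (-1 : ℝ) ^ J.card * x (S ∪ J) ∧
      ∑ J ∈ T.powerset, (-1 : ℝ) ^ J.card * x (S ∪ J) ≤ x S := by
  induction T using Finset.induction_on generalizing S with
  | empty => simp
  | insert i T hi ih =>
    obtain ⟨hiS, hd⟩ := Finset.disjoint_insert_right.mp hST
    rw [Finset.card_insert_of_notMem hi, Nat.cast_add_one] at hT ⊢
    have hTL : (T.card : ℝ) ≤ L := by linarith
    obtain ⟨hl, hu⟩ := ih hd hTL
    obtain ⟨hl', hu'⟩ := ih (S := insert i S) (Finset.disjoint_insert_left.mpr ⟨hi, hd⟩) hTL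
    have hnonneg : 0 ≤ x (insert i S) * (1 - T.card / L) :=
      mul_nonneg (hnn _) (sub_nonneg.mpr ((div_le_one hL).mpr hTL))
    rw [alternating_sum_powerset_insert x S hi]
    refine ⟨?_, by linarith⟩
    calc x S * (1 - (T.card + 1) / L) = x S * (1 - T.card / L) - x S / L := by ring
      _ ≤ _ := sub_le_sub hl (hu'.trans (hdec S i hiS))

/-- Let `V` be a finite set, `L ≥ 1` a real number, and
`x : Finset V → ℝ` nonnegative with `x (insert i S) ≤ x S / L` for `i ∉ S`.
Then for disjoint `S T` with `|T| ≤ L / 2`,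
`x S / 2 ≤ ∑_{J ⊆ T} (-1)^|J| x (S ∪ J) ≤ x S`. -/
theorem sherali_adams_dominate {V : Type*} [DecidableEq V] [Fintype V]
    (L : ℝ) (hL : 1 ≤ L)
    (x : Finset V → ℝ) (hnn : ∀ S : Finset V, 0 ≤ x S)
    (hdec : ∀ (S : Finset V), ∀ i ∉ S, x (insert i S) ≤ x S / L)
    (S T : Finset V) (hST : Disjoint S T) (hT : (T.card : ℝ) ≤ L / 2) :
    x S / 2 ≤ ∑ J ∈ T.powerset, (-1 : ℝ) ^ J.card * x (S ∪ J) ∧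
      ∑ J ∈ T.powerset, (-1 : ℝ) ^ J.card * x (S ∪ J) ≤ x S := by
  have hL0 : 0 < L := by linarith
  obtain ⟨hl, hu⟩ := alternating_sum_powerset_bounds hL0 hnn hdec hST (by linarith)
  refine ⟨le_trans ?_ hl, hu⟩
  have hTL : (T.card : ℝ) / L ≤ 1 / 2 := by
    rw [div_le_iff₀ hL0]
    linarith
  calc x S / 2 = x S * (1 / 2) := by ring
    _ ≤ _ := mul_le_mul_of_nonneg_left (by linarith) (hnn S)
end

section
/- Let n ≥ 9 and L ≥ 1. Let G = (V,E) be a simple graph on n vertices in which every vertex has degree at least (√n · log n)/2 and every two distinct vertices have at least one common neighbor. Define x_S = n^{−(st(S)+1)/4} · L^{−|S|} for nonempty S ⊆ V, where st(S) is the minimum Steiner tree size of S in G. Then for every nonempty S ⊆ V and every i ∈ S, the density constraint holds: Σ_{j∈Γ(i)} x_{S∪{j}} ≥ (n^{1/4}/L) · x_S. -/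
/-- The minimum Steiner tree size of a nonempty set `S` of vertices in `G`:
the least cardinality of a set `T ⊇ S` inducing a connected subgraph of `G`. -/
noncomputable def steinerSize {n : ℕ} (G : SimpleGraph (Fin n)) (S : Finset (Fin n)) : ℕ :=
  sInf {m : ℕ | ∃ T : Finset (Fin n), S ⊆ T ∧ T.card = m ∧
    (G.induce (T : Set (Fin n))).Connected}

/-- In a connected graph, the minimum Steiner tree size is attained: every set
of vertices is contained in a set of `steinerSize` many vertices inducing a connected subgraph. -/
theorem exists_card_eq_steinerSize {n : ℕ} {G : SimpleGraph (Fin n)} (hG : G.Connected)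
    (S : Finset (Fin n)) :
    ∃ T : Finset (Fin n), S ⊆ T ∧ T.card = steinerSize G S ∧
      (G.induce (T : Set (Fin n))).Connected := by
  refine Nat.sInf_mem (s := {m : ℕ | ∃ T : Finset (Fin n), S ⊆ T ∧ T.card = m ∧
    (G.induce (T : Set (Fin n))).Connected}) ⟨_, Finset.univ, Finset.subset_univ S, rfl, ?_⟩
  rw [Finset.coe_univ]
  exact (SimpleGraph.induceUnivIso G).connected_iff.mpr hG

/-- Adding a neighbor of a terminal increases the minimum Steiner tree size by at most one. -/
theorem steinerSize_insert_le {n : ℕ} {G : SimpleGraph (Fin n)} (hG : G.Connected)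
    {S : Finset (Fin n)} {i j : Fin n} (hi : i ∈ S) (hij : G.Adj i j) :
    steinerSize G (insert j S) ≤ steinerSize G S + 1 := by
  obtain ⟨T, hST, hT, hconn⟩ := exists_card_eq_steinerSize hG S
  rw [← hT]
  refine le_trans (Nat.sInf_le ⟨insert j T, Finset.insert_subset_insert j hST, rfl, ?_⟩)
    (Finset.card_insert_le j T)
  have hins : ((insert j T : Finset (Fin n)) : Set (Fin n)) = {i, j} ∪ (T : Set (Fin n)) := by
    rw [Finset.coe_insert, Set.insert_union, Set.singleton_union, Set.insert_comm,
      Set.insert_eq_of_mem (Finset.mem_coe.mpr (hST hi))]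
  rw [hins]
  exact SimpleGraph.induce_union_connected
    (SimpleGraph.induce_pair_connected_of_adj hij).preconnected hconn.preconnected
    ⟨i, by simp, hST hi⟩

/-- A nonempty graph in which distinct vertices have a common neighbor is connected. -/
theorem connected_of_common_neighbor {V : Type*} [Nonempty V] {G : SimpleGraph V}
    (hcommon : ∀ u v : V, u ≠ v → ∃ w : V, G.Adj u w ∧ G.Adj v w) : G.Connected := by
  refine ⟨fun u v => ?_⟩
  rcases eq_or_ne u v with rfl | huv
  · exact SimpleGraph.Reachable.refl _
  · obtain ⟨w, huw, hvw⟩ := hcommon u v huv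
    exact huw.reachable.trans hvw.symm.reachable

theorem two_le_log_of_nine_le {n : ℕ} (hn : 9 ≤ n) : 2 ≤ Real.log n := by
  rw [Real.le_log_iff_exp_le (by positivity)]
  have h : Real.exp 2 = Real.exp 1 * Real.exp 1 := by rw [← Real.exp_add]; norm_num
  have h9 : (9 : ℝ) ≤ n := by exact_mod_cast hn
  nlinarith [Real.exp_one_lt_d9, Real.exp_pos 1]

open Classical in
/-- Under the stated degree/common-neighbor hypotheses, the
Sherali–Adams solution `x S = n^{-(st(S)+1)/4} L^{-|S|}` satisfies the density
constraint `∑_{j ∈ Γ(i)} x (S ∪ {j}) ≥ (n^{1/4} / L) x S` for every nonempty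
`S` and every `i ∈ S`. -/
theorem density_constraint (n : ℕ) (hn : 9 ≤ n) (L : ℝ) (hL : 1 ≤ L)
    (G : SimpleGraph (Fin n))
    (hdeg : ∀ v : Fin n,
      Real.sqrt n * Real.log n / 2 ≤ (Set.ncard {u | G.Adj v u} : ℝ))
    (hcommon : ∀ u v : Fin n, u ≠ v → ∃ w : Fin n, G.Adj u w ∧ G.Adj v w)
    (x : Finset (Fin n) → ℝ)
    (hx : ∀ S : Finset (Fin n), S.Nonempty →
      x S = (n : ℝ) ^ (-(((steinerSize G S : ℝ) + 1) / 4)) * L ^ (-(S.card : ℝ)))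
    (S : Finset (Fin n)) (hS : S.Nonempty) (i : Fin n) (hi : i ∈ S) :
    (n : ℝ) ^ ((1 : ℝ) / 4) / L * x S ≤
      ∑ j : Fin n, if G.Adj i j then x (insert j S) else 0 := by
  have hn1 : (1 : ℝ) ≤ n := by exact_mod_cast (by lia : 1 ≤ n)
  have hn0 : (0 : ℝ) < n := by linarith
  have hL0 : 0 < L := by linarith
  have : Nonempty (Fin n) := ⟨i⟩
  have hG := connected_of_common_neighbor hcommon
  have hxS : 0 < x S := by
    rw [hx S hS]
    positivity
  have hterm : ∀ j, G.Adj i j → (n : ℝ) ^ (-(1 / 4) : ℝ) / L * x S ≤ x (insert j S) := by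
    intro j hij
    have hst : (steinerSize G (insert j S) : ℝ) ≤ steinerSize G S + 1 := by
      exact_mod_cast steinerSize_insert_le hG hi hij
    have hcard : ((insert j S).card : ℝ) ≤ S.card + 1 := by
      exact_mod_cast Finset.card_insert_le j S
    rw [hx S hS, hx _ (Finset.insert_nonempty j S)]
    calc (n : ℝ) ^ (-(1 / 4) : ℝ) / L *
          ((n : ℝ) ^ (-(((steinerSize G S : ℝ) + 1) / 4)) * L ^ (-(S.card : ℝ)))
        = (n : ℝ) ^ (-(1 / 4) + -(((steinerSize G S : ℝ) + 1) / 4)) *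
            L ^ (-1 + -(S.card : ℝ)) := by
          rw [Real.rpow_add hn0, Real.rpow_add hL0, Real.rpow_neg_one]
          ring
      _ ≤ _ := by
          gcongr ?_ * ?_
          · exact Real.rpow_le_rpow_of_exponent_le hn1 (by linarith)
          · exact Real.rpow_le_rpow_of_exponent_le hL (by linarith)
  have hsqrt : √(n : ℝ) ≤ (Set.ncard {u | G.Adj i u} : ℝ) := by
    refine le_trans ?_ (hdeg i)
    nlinarith [two_le_log_of_nine_le hn, Real.sqrt_nonneg (n : ℝ)]
  have hpow : (n : ℝ) ^ ((1 : ℝ) / 4) = √(n : ℝ) * (n : ℝ) ^ (-(1 / 4) : ℝ) := by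
    rw [Real.sqrt_eq_rpow, ← Real.rpow_add hn0]
    norm_num
  have hncard : (Set.ncard {u | G.Adj i u}) = (Finset.univ.filter (G.Adj i)).card := by
    rw [← Set.ncard_coe_finset]
    simp
  rw [← Finset.sum_filter]
  calc (n : ℝ) ^ ((1 : ℝ) / 4) / L * x S
      = √(n : ℝ) * ((n : ℝ) ^ (-(1 / 4) : ℝ) / L * x S) := by rw [hpow]; ring
    _ ≤ (Finset.univ.filter (G.Adj i)).card * ((n : ℝ) ^ (-(1 / 4) : ℝ) / L * x S) := by
        rw [← hncard]
        gcongr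
    _ ≤ ∑ j ∈ Finset.univ.filter (G.Adj i), x (insert j S) := by
        rw [← nsmul_eq_mul]
        exact Finset.card_nsmul_le_sum _ _ _ fun j hj => hterm j (Finset.mem_filter.mp hj).2
end

section
/- Let G = (V,E) be a simple graph on n vertices in which every two distinct vertices have at least one common neighbor and at most (log n)^2 common neighbors. Then for every nonempty S ⊆ V, the number of vertices i ∈ V \ S with st(S∪{i}) = st(S) is at most (2|S|·log n)^{2|S|}. -/
/-- If a walk in `G[T]` starts in `A ⊆ T` and ends outside `A`, then the starting vertex can be
joined inside `G[A]` to a vertex that has a neighbor in `T \ A`. -/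
theorem exists_reachable_boundary {V : Type*} (G : SimpleGraph V) {A T : Set V}
    {x y : T} (p : (G.induce T).Walk x y) (hx : (x : V) ∈ A) (hy : (y : V) ∉ A) :
    ∃ (b : A) (u : V), u ∈ T ∧ u ∉ A ∧ G.Adj u b ∧ (G.induce A).Reachable ⟨x, hx⟩ b := by
  induction p with
  | nil => exact absurd hx hy
  | @cons x z y h q ih =>
    have hadj : G.Adj (x : V) z := h
    by_cases hz : (z : V) ∈ A
    · obtain ⟨b, u, huT, huA, hub, hr⟩ := ih hz hy
      refine ⟨b, u, huT, huA, hub, SimpleGraph.Reachable.trans ?_ hr⟩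
      exact SimpleGraph.Adj.reachable (G := G.induce A) (u := ⟨x, hx⟩) (v := ⟨z, hz⟩) hadj
    · exact ⟨⟨x, hx⟩, z, z.2, hz, hadj.symm, SimpleGraph.Reachable.refl _⟩

/-- In a graph where any two distinct vertices have a common neighbor, a set `A` all of whose
vertices reach a nonempty `P ⊆ A` inside `G[A]` becomes connected after adding fewer than
`P.card` vertices. -/
theorem exists_connected_superset {V : Type*} [DecidableEq V] (G : SimpleGraph V)
    (hG : ∀ u v : V, u ≠ v → ∃ w, G.Adj u w ∧ G.Adj v w)
    {A P : Finset V} (hP : P.Nonempty) (hPA : P ⊆ A)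
    (hreach : ∀ a : (A : Set V), ∃ p : (A : Set V),
      (p : V) ∈ P ∧ (G.induce (A : Set V)).Reachable a p) :
    ∃ T : Finset V, A ⊆ T ∧ T.card < A.card + P.card ∧ (G.induce (T : Set V)).Connected := by
  obtain ⟨p₀, hp₀⟩ := hP
  have hc : ∀ p : V, ∃ w, p ≠ p₀ → G.Adj p w ∧ G.Adj p₀ w := fun p => by
    by_cases h : p = p₀
    · exact ⟨p₀, fun h' => absurd h h'⟩
    · obtain ⟨w, hw⟩ := hG p p₀ h
      exact ⟨w, fun _ => hw⟩
  choose c hc using hc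
  set T := A ∪ (P.erase p₀).image c with hT
  have hAT : A ⊆ T := Finset.subset_union_left
  have hAT' : (A : Set V) ⊆ (T : Set V) := by exact_mod_cast hAT
  refine ⟨T, hAT, ?_, ?_⟩
  · have h1 := Finset.card_union_le A ((P.erase p₀).image c)
    have h2 := Finset.card_image_le (s := P.erase p₀) (f := c)
    have h3 := Finset.card_erase_lt_of_mem hp₀
    rw [← hT] at h1
    omega
  · have hp₀T : p₀ ∈ (T : Set V) := hAT' (hPA hp₀)
    have hcT : ∀ p ∈ P, p ≠ p₀ → c p ∈ (T : Set V) := fun p hp hne =>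
      Finset.mem_coe.2 (Finset.mem_union_right _
        (Finset.mem_image_of_mem _ (Finset.mem_erase.2 ⟨hne, hp⟩)))
    have hcR : ∀ (p : V) (hp : p ∈ P) (hne : p ≠ p₀),
        (G.induce (T : Set V)).Reachable ⟨c p, hcT p hp hne⟩ ⟨p₀, hp₀T⟩ := fun p hp hne =>
      SimpleGraph.Adj.reachable (G := G.induce (T : Set V)) (u := ⟨c p, hcT p hp hne⟩)
        (v := ⟨p₀, hp₀T⟩) (hc p hne).2.symm
    have hPR : ∀ (p : V) (hp : p ∈ P),
        (G.induce (T : Set V)).Reachable ⟨p, hAT' (hPA hp)⟩ ⟨p₀, hp₀T⟩ := fun p hp => by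
      by_cases hne : p = p₀
      · subst hne
        exact SimpleGraph.Reachable.refl _
      · refine SimpleGraph.Reachable.trans ?_ (hcR p hp hne)
        exact SimpleGraph.Adj.reachable (G := G.induce (T : Set V))
          (u := ⟨p, hAT' (hPA hp)⟩) (v := ⟨c p, hcT p hp hne⟩) (hc p hne).1
    have hR : ∀ x : (T : Set V), (G.induce (T : Set V)).Reachable x ⟨p₀, hp₀T⟩ := by
      rintro ⟨x, hx⟩
      rcases Finset.mem_union.1 (Finset.mem_coe.1 hx) with hxA | hxc
      · obtain ⟨⟨p, hpA⟩, hp, hr⟩ := hreach ⟨x, hxA⟩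
        exact (hr.map (SimpleGraph.induceHomOfLE G hAT').toHom).trans (hPR p hp)
      · obtain ⟨p, hp, rfl⟩ := Finset.mem_image.1 hxc
        exact hcR p (Finset.mem_of_mem_erase hp) (Finset.ne_of_mem_erase hp)
    exact { preconnected := fun x y => (hR x).trans (hR y).symm, nonempty := ⟨⟨p₀, hp₀T⟩⟩ }

/-- `T` is generated from `A` by repeatedly adding common neighbors: every proper subset of `T`
containing `A` misses a vertex of `T` with two distinct neighbors in that subset. -/
def IsCommonNeighborGenerated {V : Type*} (G : SimpleGraph V) (A T : Finset V) : Prop :=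
  ∀ B : Finset V, A ⊆ B → B ⊂ T →
    ∃ v ∈ T, v ∉ B ∧ ∃ x ∈ B, ∃ y ∈ B, x ≠ y ∧ G.Adj x v ∧ G.Adj y v

theorem steinerSize_le {n : ℕ} {G : SimpleGraph (Fin n)} {S T : Finset (Fin n)} (hST : S ⊆ T)
    (hT : (G.induce (T : Set (Fin n))).Connected) : steinerSize G S ≤ T.card :=
  Nat.sInf_le ⟨T, hST, rfl, hT⟩

theorem exists_connected_card_lt_two_mul {n : ℕ} {G : SimpleGraph (Fin n)}
    (hG : ∀ u v : Fin n, u ≠ v → ∃ w, G.Adj u w ∧ G.Adj v w)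
    {S : Finset (Fin n)} (hS : S.Nonempty) :
    ∃ T : Finset (Fin n), S ⊆ T ∧ T.card < 2 * S.card ∧
      (G.induce (T : Set (Fin n))).Connected := by
  obtain ⟨T, h1, h2, h3⟩ := exists_connected_superset G hG hS (Finset.Subset.refl S)
    fun a => ⟨a, a.2, SimpleGraph.Reachable.refl _⟩
  exact ⟨T, h1, by omega, h3⟩

/-- A minimum Steiner tree is generated from its terminals by adding common neighbors. -/
theorem isCommonNeighborGenerated_of_card_eq_steinerSize {n : ℕ} {G : SimpleGraph (Fin n)}
    (hG : ∀ u v : Fin n, u ≠ v → ∃ w, G.Adj u w ∧ G.Adj v w)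
    {S T : Finset (Fin n)} (hS : S.Nonempty) (hcard : T.card = steinerSize G S)
    (hT : (G.induce (T : Set (Fin n))).Connected) : IsCommonNeighborGenerated G S T := by
  classical
  intro A hSA hAT
  by_contra! hno
  obtain ⟨s, hs⟩ := hS
  obtain ⟨u₀, hu₀T, hu₀A⟩ := Finset.exists_of_ssubset hAT
  replace hAT := hAT.subset
  set P := A.filter fun a => ∃ u ∈ T \ A, G.Adj u a with hPdef
  have hPcard : P.card ≤ (T \ A).card := by
    have hex : ∀ a ∈ P, ∃ u ∈ T \ A, G.Adj u a := fun a ha => (Finset.mem_filter.1 ha).2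
    choose! f hfT hf using hex
    refine Finset.card_le_card_of_injOn f (fun a ha => hfT a ha) ?_
    intro a ha b hb hab
    by_contra hne
    have h := Finset.mem_sdiff.1 (hfT a ha)
    exact hno (f a) h.1 h.2 a (Finset.mem_filter.1 ha).1 b (Finset.mem_filter.1 hb).1 hne
      (hf a ha).symm (hab ▸ (hf b hb).symm)
  have hreach : ∀ a : (A : Set (Fin n)), ∃ p : (A : Set (Fin n)),
      (p : Fin n) ∈ P ∧ (G.induce (A : Set (Fin n))).Reachable a p := by
    rintro ⟨a, ha⟩
    obtain ⟨w⟩ := hT.preconnected ⟨a, hAT ha⟩ ⟨u₀, hu₀T⟩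
    obtain ⟨b, u, huT, huA, hub, hr⟩ := exists_reachable_boundary G w ha hu₀A
    exact ⟨b, Finset.mem_filter.2 ⟨b.2, u, Finset.mem_sdiff.2 ⟨huT, huA⟩, hub⟩, hr⟩
  obtain ⟨p, hp, -⟩ := hreach ⟨s, hSA hs⟩
  obtain ⟨T', hAT', hcard', hT'⟩ :=
    exists_connected_superset G hG ⟨p, hp⟩ (Finset.filter_subset _ _) hreach
  have h1 := steinerSize_le (hSA.trans hAT') hT'
  have h2 := Finset.card_sdiff_add_card_eq_card hAT
  change T'.card < A.card + P.card at hcard'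
  omega

/-- If distinct vertices have at most `l` common neighbors, few vertices lie in sets with at most
`m` new elements generated from `A` by adding common neighbors. -/
theorem ncard_generated_add_one_le {V : Type*} [Finite V] (G : SimpleGraph V) {l K : ℕ}
    (hl : ∀ u v : V, u ≠ v → Set.ncard {w | G.Adj u w ∧ G.Adj v w} ≤ l)
    (m : ℕ) (A : Finset V) (hA : A.card + m ≤ K) :
    Set.ncard {i | i ∉ A ∧ ∃ T : Finset V, A ⊆ T ∧ i ∈ T ∧ T.card ≤ A.card + m ∧
      IsCommonNeighborGenerated G A T} + 1 ≤ (K ^ 2 * l + 1) ^ m := by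
  classical
  have := Fintype.ofFinite V
  induction m generalizing A with
  | zero =>
    have : {i | i ∉ A ∧ ∃ T : Finset V, A ⊆ T ∧ i ∈ T ∧ T.card ≤ A.card + 0 ∧
        IsCommonNeighborGenerated G A T} = ∅ := by
      ext i
      simp only [Set.mem_ofPred_eq, Set.mem_empty_iff_false, iff_false]
      rintro ⟨hi, T, hAT, hiT, hc, -⟩
      exact hi (Finset.eq_of_subset_of_card_le hAT hc ▸ hiT)
    simp only [this, Set.ncard_empty, pow_zero, zero_add, le_refl]
  | succ m ih =>
    set N : Finset V := A.offDiag.biUnion fun q =>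
      Finset.univ.filter fun w => G.Adj q.1 w ∧ G.Adj q.2 w with hN
    have hNcard : (N \ A).card ≤ K ^ 2 * l := by
      calc (N \ A).card ≤ N.card := Finset.card_le_card Finset.sdiff_subset
        _ ≤ A.offDiag.card * l := by
          refine Finset.card_biUnion_le_card_mul _ _ _ fun q hq => ?_
          have h := hl q.1 q.2 (Finset.mem_offDiag.1 hq).2.2
          rwa [Set.ncard_eq_toFinset_card', Set.toFinset_ofPred] at h
        _ ≤ K ^ 2 * l := by
          refine Nat.mul_le_mul_right _ ?_
          rw [Finset.offDiag_card]
          have : A.card ≤ K := by omega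
          nlinarith [Nat.sub_le (A.card * A.card) A.card]
    set X : Finset V → Set V := fun B => {i | i ∉ B ∧ ∃ T : Finset V, B ⊆ T ∧ i ∈ T ∧
      T.card ≤ B.card + m ∧ IsCommonNeighborGenerated G B T} with hX
    have hsub : {i | i ∉ A ∧ ∃ T : Finset V, A ⊆ T ∧ i ∈ T ∧ T.card ≤ A.card + (m + 1) ∧
        IsCommonNeighborGenerated G A T} ⊆
        (((N \ A).biUnion fun v => insert v (X (insert v A)).toFinset : Finset V) : Set V) := by
      rintro i ⟨hi, T, hAT, hiT, hc, hgen⟩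
      have hss : A ⊂ T := Finset.ssubset_iff_subset_ne.2 ⟨hAT, fun h => hi (h ▸ hiT)⟩
      obtain ⟨v, hvT, hvA, x, hx, y, hy, hxy, hxv, hyv⟩ := hgen A (Finset.Subset.refl A) hss
      have hvN : v ∈ N \ A := Finset.mem_sdiff.2 ⟨Finset.mem_biUnion.2
        ⟨(x, y), Finset.mem_offDiag.2 ⟨hx, hy, hxy⟩, by simp [hxv, hyv]⟩, hvA⟩
      refine Finset.mem_coe.2 (Finset.mem_biUnion.2 ⟨v, hvN, ?_⟩)
      by_cases hiv : i = v
      · exact hiv ▸ Finset.mem_insert_self _ _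
      · refine Finset.mem_insert_of_mem (Set.mem_toFinset.2 ⟨?_, T, ?_, hiT, ?_, ?_⟩)
        · simp [hiv, hi]
        · exact Finset.insert_subset hvT hAT
        · rw [Finset.card_insert_of_notMem hvA]
          omega
        · exact fun B hB => hgen B ((Finset.subset_insert _ _).trans hB)
    have hcard := Set.ncard_le_ncard hsub (Finset.finite_toSet _)
    rw [Set.ncard_coe_finset] at hcard
    have hbi : ((N \ A).biUnion fun v => insert v (X (insert v A)).toFinset).card ≤
        (N \ A).card * (K ^ 2 * l + 1) ^ m := by
      refine Finset.card_biUnion_le_card_mul _ _ _ fun v hv => ?_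
      have hvA := (Finset.mem_sdiff.1 hv).2
      have h := ih (insert v A) (by rw [Finset.card_insert_of_notMem hvA]; omega)
      refine (Finset.card_insert_le _ _).trans ?_
      rwa [← Set.ncard_eq_toFinset_card']
    have hpos : 1 ≤ (K ^ 2 * l + 1) ^ m := Nat.one_le_pow _ _ (Nat.succ_pos _)
    have hmul := Nat.mul_le_mul_right ((K ^ 2 * l + 1) ^ m) hNcard
    rw [pow_succ, mul_add, mul_one, mul_comm _ (K ^ 2 * l)]
    omega

/-- If in `G` every two distinct vertices have at least one and at most
`(log n)²` common neighbors, then for every nonempty `S`, the number of vertices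
`i ∉ S` with `st(S ∪ {i}) = st(S)` is at most `(2|S| log n)^{2|S|}`. -/
theorem count_same_steiner (n : ℕ) (G : SimpleGraph (Fin n))
    (hcommon : ∀ u v : Fin n, u ≠ v →
      1 ≤ Set.ncard {w : Fin n | G.Adj u w ∧ G.Adj v w} ∧
      (Set.ncard {w : Fin n | G.Adj u w ∧ G.Adj v w} : ℝ) ≤ (Real.log n) ^ 2)
    (S : Finset (Fin n)) (hS : S.Nonempty) :
    (Set.ncard {i : Fin n | i ∉ S ∧ steinerSize G (insert i S) = steinerSize G S} : ℝ) ≤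
      (2 * S.card * Real.log n) ^ (2 * S.card) := by
  have hG : ∀ u v : Fin n, u ≠ v → ∃ w, G.Adj u w ∧ G.Adj v w := fun u v huv =>
    Set.nonempty_of_ncard_ne_zero (Nat.one_le_iff_ne_zero.1 (hcommon u v huv).1)
  set l := ⌊(Real.log n) ^ 2⌋₊ with hldef
  have hl : ∀ u v : Fin n, u ≠ v → Set.ncard {w | G.Adj u w ∧ G.Adj v w} ≤ l :=
    fun u v huv => Nat.le_floor (hcommon u v huv).2
  have hlR : (l : ℝ) ≤ (Real.log n) ^ 2 := Nat.floor_le (sq_nonneg _)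
  rcases Set.eq_empty_or_nonempty
    {i : Fin n | i ∉ S ∧ steinerSize G (insert i S) = steinerSize G S} with hempty | ⟨i₀, hi₀, -⟩
  · rw [hempty, Set.ncard_empty, Nat.cast_zero, pow_mul]
    positivity
  obtain ⟨s, hs⟩ := hS
  have hne : i₀ ≠ s := fun h => hi₀ (h ▸ hs)
  have hl1 : 1 ≤ l := (hcommon i₀ s hne).1.trans (hl i₀ s hne)
  obtain ⟨j, hj⟩ : ∃ j, S.card = j + 1 :=
    ⟨S.card - 1, by have := Finset.card_pos.2 ⟨s, hs⟩; omega⟩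
  have hsub : {i : Fin n | i ∉ S ∧ steinerSize G (insert i S) = steinerSize G S} ⊆
      {i | i ∉ S ∧ ∃ T : Finset (Fin n), S ⊆ T ∧ i ∈ T ∧ T.card ≤ S.card + j ∧
        IsCommonNeighborGenerated G S T} := by
    rintro i ⟨hi, heq⟩
    obtain ⟨T₁, hT₁, -, hT₁c⟩ := exists_connected_card_lt_two_mul hG (Finset.insert_nonempty i S)
    obtain ⟨T, hiST, hTcard, hT⟩ : ∃ T : Finset (Fin n), insert i S ⊆ T ∧
        T.card = steinerSize G (insert i S) ∧ (G.induce (T : Set (Fin n))).Connected :=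
      Nat.sInf_mem (s := {m : ℕ | ∃ T : Finset (Fin n), insert i S ⊆ T ∧ T.card = m ∧
        (G.induce (T : Set (Fin n))).Connected}) ⟨_, T₁, hT₁, rfl, hT₁c⟩
    obtain ⟨T₂, hT₂, hlt, hT₂c⟩ := exists_connected_card_lt_two_mul hG ⟨s, hs⟩
    have hle := steinerSize_le hT₂ hT₂c
    exact ⟨hi, T, (Finset.subset_insert _ _).trans hiST, hiST (Finset.mem_insert_self _ _),
      by omega, isCommonNeighborGenerated_of_card_eq_steinerSize hG ⟨s, hs⟩ (hTcard.trans heq) hT⟩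
  have hcount := (Set.ncard_le_ncard hsub (Set.toFinite _)).trans (Nat.le_of_succ_le
    (ncard_generated_add_one_le G hl j S (K := 2 * j + 1) (by omega)))
  have hbase : (2 * j + 1) ^ 2 * l + 1 ≤ (2 * S.card) ^ 2 * l := by
    rw [hj]
    nlinarith
  have hnat : Set.ncard {i : Fin n | i ∉ S ∧ steinerSize G (insert i S) = steinerSize G S} ≤
      ((2 * S.card) ^ 2 * l) ^ S.card :=
    hcount.trans ((Nat.pow_le_pow_left hbase j).trans
      (Nat.pow_le_pow_right (by omega) (by omega)))
  calc (Set.ncard {i : Fin n | i ∉ S ∧ steinerSize G (insert i S) = steinerSize G S} : ℝ)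
      ≤ ((2 * S.card : ℝ) ^ 2 * l) ^ S.card := by exact_mod_cast hnat
    _ ≤ ((2 * S.card : ℝ) ^ 2 * (Real.log n) ^ 2) ^ S.card := by gcongr
    _ = (2 * S.card * Real.log n) ^ (2 * S.card) := by rw [pow_mul, ← mul_pow]
end

section
/- Let G = (V,E) be a simple graph on n vertices in which every two distinct vertices have at least one common neighbor and at most (log n)^2 common neighbors, and in which every vertex has degree at most 2√n · log n. Then for every nonempty S ⊆ V, the number of vertices i ∈ V \ S with st(S∪{i}) = st(S)+1 is at most (4|S|·log n)^{4|S|} · √n. -/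
/-- If every two distinct vertices have a common neighbor, a nonempty set `C` inducing `c`
connected components extends to a connected set by adding at most `c - 1` vertices. -/
theorem exists_connected_superset_s4 {V : Type*} [Fintype V] [DecidableEq V] (G : SimpleGraph V)
    (hG : ∀ u v : V, u ≠ v → ∃ w, G.Adj u w ∧ G.Adj v w) (C : Finset V) (hC : C.Nonempty) :
    ∃ T : Finset V, C ⊆ T ∧
      T.card + 1 ≤ C.card + Nat.card (G.induce (C : Set V)).ConnectedComponent ∧
      (G.induce (T : Set V)).Connected := by
  classical
  obtain ⟨v₀, hv₀⟩ := hC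
  let H := G.induce (C : Set V)
  let k₀ : H.ConnectedComponent := H.connectedComponentMk ⟨v₀, hv₀⟩
  have key : ∀ k : H.ConnectedComponent, ∃ w : V, k ≠ k₀ →
      ∃ r : (C : Set V), H.connectedComponentMk r = k ∧ G.Adj v₀ w ∧ G.Adj r w := by
    intro k
    induction k using SimpleGraph.ConnectedComponent.ind with
    | h r =>
      by_cases h : (r : V) = v₀
      · refine ⟨v₀, fun hk => (hk ?_).elim⟩
        have : r = ⟨v₀, hv₀⟩ := Subtype.ext h
        rw [this]
      · obtain ⟨w, hw⟩ := hG v₀ r (Ne.symm h)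
        exact ⟨w, fun _ => ⟨r, rfl, hw⟩⟩
  choose w hw using key
  refine ⟨C ∪ (Finset.univ.erase k₀).image w, Finset.subset_union_left, ?_, ?_⟩
  · have h1 := Finset.card_union_le C ((Finset.univ.erase k₀).image w)
    have h2 : ((Finset.univ.erase k₀).image w).card ≤ (Finset.univ.erase k₀).card :=
      Finset.card_image_le
    have h3 := Finset.card_erase_add_one (Finset.mem_univ k₀)
    rw [Finset.card_univ, ← Nat.card_eq_fintype_card] at h3
    change _ ≤ C.card + Nat.card H.ConnectedComponent
    omega
  · set T : Finset V := C ∪ (Finset.univ.erase k₀).image w with hT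
    have hCT : C ⊆ T := Finset.subset_union_left
    have hadj : ∀ {a b : V} (ha : a ∈ (T : Set V)) (hb : b ∈ (T : Set V)), G.Adj a b →
        (G.induce (T : Set V)).Reachable ⟨a, ha⟩ ⟨b, hb⟩ := fun ha hb h =>
      SimpleGraph.Adj.reachable (by simpa using h)
    have hlift : ∀ {a b : (C : Set V)}, H.Reachable a b →
        (G.induce (T : Set V)).Reachable ⟨a, hCT a.2⟩ ⟨b, hCT b.2⟩ := fun h =>
      h.map (SimpleGraph.induceHomOfLE G (show (C : Set V) ≤ T from hCT)).toHom
    have hwT : ∀ k, k ≠ k₀ → w k ∈ (T : Set V) := fun k hk =>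
      Finset.mem_union_right _ (Finset.mem_image_of_mem _ (by simp [hk]))
    have hreach : ∀ x : (T : Set V),
        (G.induce (T : Set V)).Reachable ⟨v₀, hCT hv₀⟩ x := by
      rintro ⟨x, hx⟩
      rcases Finset.mem_union.1 hx with hxC | hxw
      · by_cases hk : H.connectedComponentMk ⟨x, hxC⟩ = k₀
        · exact (hlift (SimpleGraph.ConnectedComponent.exact hk)).symm
        · obtain ⟨r, hr, h1, h2⟩ := hw _ hk
          exact ((hadj (hCT hv₀) (hwT _ hk) h1).trans
            (hadj (hCT r.2) (hwT _ hk) h2).symm).trans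
            (hlift (SimpleGraph.ConnectedComponent.exact hr))
      · obtain ⟨k, hk, rfl⟩ := Finset.mem_image.1 hxw
        obtain ⟨r, hr, h1, h2⟩ := hw k (Finset.ne_of_mem_erase hk)
        exact hadj (hCT hv₀) _ h1
    exact SimpleGraph.Connected.mk
      (nonempty := ⟨⟨v₀, hCT hv₀⟩⟩) fun a b => (hreach a).symm.trans (hreach b)

/-- If `T` is connected, no vertex of `T \ C` has two neighbors in `C`, and `i ∈ T \ C` has
none, then `C` induces fewer components than `T \ C` has vertices. -/
theorem card_components_lt_card_sdiff {V : Type*} [Fintype V] [DecidableEq V]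
    (G : SimpleGraph V) (C T : Finset V) (hCT : C ⊆ T) (hT : (G.induce (T : Set V)).Connected)
    (hclosed : ∀ v ∈ T, v ∉ C → ∀ a ∈ C, ∀ b ∈ C, G.Adj a v → G.Adj b v → a = b)
    (i : V) (hiT : i ∈ T) (hiC : i ∉ C) (hi : ∀ a ∈ C, ¬ G.Adj a i) :
    Nat.card (G.induce (C : Set V)).ConnectedComponent + 1 ≤ (T \ C).card := by
  classical
  let H := G.induce (C : Set V)
  have key : ∀ k : H.ConnectedComponent, ∃ y : V, y ∈ T ∧ y ∉ C ∧
      ∃ x : (C : Set V), H.connectedComponentMk x = k ∧ G.Adj x y := by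
    intro k
    induction k using SimpleGraph.ConnectedComponent.ind with
    | h r =>
      obtain ⟨p⟩ := hT.preconnected ⟨r, hCT r.2⟩ ⟨i, hiT⟩
      obtain ⟨d, -, ⟨hd, hd'⟩, hd2⟩ := p.exists_boundary_dart
        {x | ∃ h : (x : V) ∈ (C : Set V), H.connectedComponentMk ⟨x, h⟩ =
          H.connectedComponentMk r} ⟨r.2, rfl⟩ (fun ⟨h, _⟩ => hiC h)
      have hadj : G.Adj d.fst d.snd := by simpa using d.adj
      refine ⟨d.snd, d.snd.2, fun h => hd2 ⟨h, ?_⟩, ⟨d.fst, hd⟩, hd', hadj⟩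
      rw [← hd']
      refine SimpleGraph.ConnectedComponent.sound (SimpleGraph.Adj.reachable ?_)
      simpa [H] using hadj.symm
  choose f hfT hfC x hx hadj using key
  have hinj : Function.Injective f := by
    intro k k' h
    have h' := hadj k'
    rw [← h] at h'
    have := hclosed (f k) (hfT k) (hfC k) _ (x k).2 _ (x k').2 (hadj k) h'
    rw [← hx k, ← hx k', Subtype.ext this]
  have hsub : insert i (Finset.univ.image f) ⊆ T \ C := by
    intro y hy
    rcases Finset.mem_insert.1 hy with rfl | hy
    · exact Finset.mem_sdiff.2 ⟨hiT, hiC⟩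
    · obtain ⟨k, -, rfl⟩ := Finset.mem_image.1 hy
      exact Finset.mem_sdiff.2 ⟨hfT k, hfC k⟩
  have hnot : i ∉ Finset.univ.image f := by
    intro h
    obtain ⟨k, -, hk⟩ := Finset.mem_image.1 h
    exact hi _ (x k).2 (hk ▸ hadj k)
  have := Finset.card_le_card hsub
  rwa [Finset.card_insert_of_notMem hnot, Finset.card_image_of_injective _ hinj,
    Finset.card_univ, ← Nat.card_eq_fintype_card] at this

open Classical in
/-- The vertices lying in `C` or having two distinct neighbors in `C`. -/
noncomputable def doublyAttached {V : Type*} [Fintype V] (G : SimpleGraph V) (C : Finset V) :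
    Finset V :=
  {v | v ∈ C ∨ ∃ a ∈ C, ∃ b ∈ C, a ≠ b ∧ G.Adj a v ∧ G.Adj b v}

/-- The sets obtained from `S` by `j` times inserting a vertex that is already present or has
two distinct neighbors in the current set. -/
noncomputable def percolationSets {V : Type*} [Fintype V] [DecidableEq V] (G : SimpleGraph V)
    (S : Finset V) : ℕ → Finset (Finset V)
  | 0 => {S}
  | j + 1 => (percolationSets G S j).biUnion fun C =>
      (doublyAttached G C).image fun v => insert v C

section Percolation

variable {V : Type*} [Fintype V] [DecidableEq V] (G : SimpleGraph V) (S : Finset V)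

theorem insert_mem_percolationSets {j : ℕ} {C : Finset V} (hC : C ∈ percolationSets G S j)
    {v : V} (hv : v ∈ doublyAttached G C) : insert v C ∈ percolationSets G S (j + 1) :=
  Finset.mem_biUnion.2 ⟨C, hC, Finset.mem_image_of_mem _ hv⟩

theorem subset_of_mem_percolationSets {j : ℕ} {C : Finset V}
    (hC : C ∈ percolationSets G S j) : S ⊆ C := by
  induction j generalizing C with
  | zero => rw [Finset.mem_singleton.1 hC]
  | succ j ih =>
    obtain ⟨D, hD, hC⟩ := Finset.mem_biUnion.1 hC
    obtain ⟨v, -, rfl⟩ := Finset.mem_image.1 hC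
    exact (ih hD).trans (Finset.subset_insert _ _)

theorem card_le_of_mem_percolationSets {j : ℕ} {C : Finset V}
    (hC : C ∈ percolationSets G S j) : C.card ≤ S.card + j := by
  induction j generalizing C with
  | zero => rw [Finset.mem_singleton.1 hC]; simp
  | succ j ih =>
    obtain ⟨D, hD, hC⟩ := Finset.mem_biUnion.1 hC
    obtain ⟨v, -, rfl⟩ := Finset.mem_image.1 hC
    have := ih hD
    have := Finset.card_insert_le v D
    omega

theorem percolationSets_mono (hS : S.Nonempty) : Monotone (percolationSets G S) := by
  refine monotone_nat_of_le_succ fun j C hC => ?_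
  obtain ⟨v, hv⟩ := hS
  have hvC := subset_of_mem_percolationSets G S hC hv
  have := insert_mem_percolationSets G S hC (v := v) (by simp [doublyAttached, hvC])
  rwa [Finset.insert_eq_of_mem hvC] at this

/-- Inside any `T ⊇ S`, percolation from `S` stabilises within `|T| - |S|` steps. -/
theorem exists_closed_mem_percolationSets (hS : S.Nonempty) {T : Finset V} (hST : S ⊆ T)
    {m : ℕ} (hm : T.card ≤ S.card + m) :
    ∃ C ∈ percolationSets G S m, C ⊆ T ∧
      ∀ v ∈ T, v ∉ C → ∀ a ∈ C, ∀ b ∈ C, G.Adj a v → G.Adj b v → a = b := by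
  classical
  let P : Finset (Finset V) :=
    {C ∈ T.powerset | C ∈ percolationSets G S (C.card - S.card)}
  have hP : P.Nonempty := ⟨S, by simp [P, hST, percolationSets]⟩
  obtain ⟨C, hCP, hmax⟩ := P.exists_max_image Finset.card hP
  obtain ⟨hCT, hC⟩ := Finset.mem_filter.1 hCP
  rw [Finset.mem_powerset] at hCT
  have hcard := Finset.card_le_card hCT
  have hSC := Finset.card_le_card (subset_of_mem_percolationSets G S hC)
  refine ⟨C, percolationSets_mono G S hS (by omega) hC, hCT, ?_⟩
  intro v hvT hvC a ha b hb hav hbv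
  by_contra hab
  have hins := insert_mem_percolationSets G S hC (v := v) (by
    simp only [doublyAttached, Finset.mem_filter_univ]
    exact Or.inr ⟨a, ha, b, hb, hab, hav, hbv⟩)
  have hc := Finset.card_insert_of_notMem hvC
  have : insert v C ∈ P := by
    refine Finset.mem_filter.2 ⟨Finset.mem_powerset.2 (Finset.insert_subset hvT hCT), ?_⟩
    rw [hc, Nat.sub_add_comm hSC]
    exact hins
  have := hmax _ this
  omega

theorem card_doublyAttached_le {c : ℝ}
    (hc : ∀ u v : V, u ≠ v → (Set.ncard {w : V | G.Adj u w ∧ G.Adj v w} : ℝ) ≤ c)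
    (hc0 : 0 ≤ c) (C : Finset V) :
    ((doublyAttached G C).card : ℝ) ≤ C.card + C.card ^ 2 * c := by
  classical
  have hsub : doublyAttached G C ⊆ C ∪ C.offDiag.biUnion fun p =>
      ({w | G.Adj p.1 w ∧ G.Adj p.2 w} : Finset V) := by
    intro v hv
    simp only [doublyAttached, Finset.mem_filter_univ] at hv
    rcases hv with hv | ⟨a, ha, b, hb, hab, h⟩
    · exact Finset.mem_union_left _ hv
    · refine Finset.mem_union_right _ (Finset.mem_biUnion.2 ⟨(a, b), ?_, ?_⟩)
      · exact Finset.mem_offDiag.2 ⟨ha, hb, hab⟩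
      · simpa using h
  have h1 : (doublyAttached G C).card ≤ C.card + ∑ p ∈ C.offDiag,
      ({w | G.Adj p.1 w ∧ G.Adj p.2 w} : Finset V).card :=
    (Finset.card_le_card hsub).trans ((Finset.card_union_le _ _).trans
      (Nat.add_le_add_left Finset.card_biUnion_le _))
  have h2 : ∑ p ∈ C.offDiag, (({w | G.Adj p.1 w ∧ G.Adj p.2 w} : Finset V).card : ℝ) ≤
      C.offDiag.card * c := by
    rw [← nsmul_eq_mul]
    refine Finset.sum_le_card_nsmul _ _ _ fun p hp => ?_
    have := hc p.1 p.2 (Finset.mem_offDiag.1 hp).2.2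
    rwa [Set.ncard_eq_toFinset_card', Set.toFinset_ofPred] at this
  have h3 : (C.offDiag.card : ℝ) ≤ C.card ^ 2 := by
    rw [Finset.offDiag_card]
    exact_mod_cast (Nat.sub_le _ _).trans (sq _).ge
  have h1' : ((doublyAttached G C).card : ℝ) ≤ C.card + ∑ p ∈ C.offDiag,
      (({w | G.Adj p.1 w ∧ G.Adj p.2 w} : Finset V).card : ℝ) := by exact_mod_cast h1
  have := mul_le_mul_of_nonneg_right h3 hc0
  linarith

theorem card_percolationSets_le {K : ℝ} {m : ℕ}
    (hK : ∀ C : Finset V, C.card ≤ S.card + m → ((doublyAttached G C).card : ℝ) ≤ K)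
    {j : ℕ} (hj : j ≤ m) : ((percolationSets G S j).card : ℝ) ≤ K ^ j := by
  induction j with
  | zero => simp [percolationSets]
  | succ j ih =>
    have hK0 : 0 ≤ K := (Nat.cast_nonneg _).trans (hK S (by omega))
    have h1 : ((percolationSets G S (j + 1)).card : ℝ) ≤
        ∑ C ∈ percolationSets G S j, ((doublyAttached G C).card : ℝ) := by
      exact_mod_cast Finset.card_biUnion_le.trans
        (Finset.sum_le_sum fun _ _ => Finset.card_image_le)
    have h2 : ∑ C ∈ percolationSets G S j, ((doublyAttached G C).card : ℝ) ≤
        (percolationSets G S j).card * K := by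
      rw [← nsmul_eq_mul]
      refine Finset.sum_le_card_nsmul _ _ _ fun C hC => hK C ?_
      have := card_le_of_mem_percolationSets G S hC
      omega
    rw [pow_succ]
    exact h1.trans (h2.trans (mul_le_mul_of_nonneg_right (ih (by omega)) hK0))

end Percolation

theorem steinerSize_le_s4 {n : ℕ} (G : SimpleGraph (Fin n))
    (hG : ∀ u v, u ≠ v → ∃ w, G.Adj u w ∧ G.Adj v w) {S C : Finset (Fin n)} (hSC : S ⊆ C)
    (hC : C.Nonempty) : steinerSize G S + 1 ≤
      C.card + Nat.card (G.induce (C : Set (Fin n))).ConnectedComponent := by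
  obtain ⟨T, hCT, hcard, hT⟩ := exists_connected_superset_s4 G hG C hC
  have : steinerSize G S ≤ T.card := Nat.sInf_le ⟨T, hSC.trans hCT, rfl, hT⟩
  omega

/-- A vertex raising the Steiner size by one lies in, or is adjacent to, some set obtained
from `S` by percolation. -/
theorem exists_percolationSet_near {n : ℕ} (G : SimpleGraph (Fin n))
    (hG : ∀ u v, u ≠ v → ∃ w, G.Adj u w ∧ G.Adj v w) {S : Finset (Fin n)} (hS : S.Nonempty)
    {i : Fin n} (hi : steinerSize G (insert i S) = steinerSize G S + 1) :
    ∃ C ∈ percolationSets G S S.card, ∃ v ∈ C, i = v ∨ G.Adj v i := by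
  obtain ⟨T, hST, hcard, hT⟩ := Nat.sInf_mem (Nat.nonempty_of_pos_sInf
    (show 0 < steinerSize G (insert i S) by omega))
  change T.card = steinerSize G (insert i S) at hcard
  have hbound := steinerSize_le_s4 G hG (Finset.Subset.refl S) hS
  have hcomp : Nat.card (G.induce (S : Set (Fin n))).ConnectedComponent ≤ S.card := by
    have := Nat.card_le_card_of_surjective (G.induce (S : Set (Fin n))).connectedComponentMk
      Quot.mk_surjective
    simpa using this
  obtain ⟨C, hC, hCT, hclosed⟩ := exists_closed_mem_percolationSets G S hS
    ((Finset.subset_insert i S).trans hST) (m := S.card) (by omega)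
  refine ⟨C, hC, ?_⟩
  by_contra! hfar
  have hSC := subset_of_mem_percolationSets G S hC
  have h1 := card_components_lt_card_sdiff G C T hCT hT hclosed i
    (hST (Finset.mem_insert_self i S)) (fun h => (hfar i h).1 rfl) (fun a ha => (hfar a ha).2)
  have h2 := steinerSize_le_s4 G hG hSC (hS.mono hSC)
  have h3 := Finset.card_sdiff_add_card_eq_card hCT
  omega

theorem card_union_neighbors_le {V : Type*} [Fintype V] [DecidableEq V] (G : SimpleGraph V)
    [DecidableRel G.Adj] {d : ℝ} (hd : ∀ v : V, (Set.ncard {u : V | G.Adj v u} : ℝ) ≤ d)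
    (C : Finset V) :
    ((C.biUnion fun v => insert v ({u | G.Adj v u} : Finset V)).card : ℝ) ≤
      C.card * (d + 1) := by
  have h1 : ((C.biUnion fun v => insert v ({u | G.Adj v u} : Finset V)).card : ℝ) ≤
      ∑ v ∈ C, ((insert v ({u | G.Adj v u} : Finset V)).card : ℝ) := by
    exact_mod_cast Finset.card_biUnion_le
  refine h1.trans ?_
  rw [← nsmul_eq_mul]
  refine Finset.sum_le_card_nsmul _ _ _ fun v _ => ?_
  have h2 := hd v
  rw [Set.ncard_eq_toFinset_card', Set.toFinset_ofPred] at h2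
  have h3 : ((insert v ({u | G.Adj v u} : Finset V)).card : ℝ) ≤
      (({u | G.Adj v u} : Finset V).card : ℝ) + 1 := by
    exact_mod_cast Finset.card_insert_le _ _
  linarith

/-- If any two distinct vertices have a common neighbor and there are at least two vertices,
then there are at least three, so `1 ≤ log n`. -/
theorem one_le_log_of_common_neighbor {n : ℕ} (G : SimpleGraph (Fin n))
    (hG : ∀ u v, u ≠ v → ∃ w, G.Adj u w ∧ G.Adj v w) {u v : Fin n} (huv : u ≠ v) :
    1 ≤ Real.log n := by
  obtain ⟨w, huw, hvw⟩ := hG u v huv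
  have h3 : 3 ≤ n := by
    have := Finset.card_le_univ ({u, v, w} : Finset (Fin n))
    rwa [Finset.card_eq_three.2 ⟨u, v, w, huv, huw.ne, hvw.ne, rfl⟩, Fintype.card_fin] at this
  rw [Real.le_log_iff_exp_le (by positivity)]
  have : (3 : ℝ) ≤ n := by exact_mod_cast h3
  linarith [Real.exp_one_lt_d9]

/-- If in `G` every two distinct vertices have at least one and at most
`(log n)²` common neighbors and every vertex has degree at most `2√n log n`, then for
every nonempty `S`, the number of vertices `i ∉ S` with `st(S ∪ {i}) = st(S) + 1` is at
most `(4|S| log n)^{4|S|} · √n`. -/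
theorem count_steiner_plus_one (n : ℕ) (G : SimpleGraph (Fin n))
    (hcommon : ∀ u v : Fin n, u ≠ v →
      1 ≤ Set.ncard {w : Fin n | G.Adj u w ∧ G.Adj v w} ∧
      (Set.ncard {w : Fin n | G.Adj u w ∧ G.Adj v w} : ℝ) ≤ (Real.log n) ^ 2)
    (hdeg : ∀ v : Fin n,
      (Set.ncard {u : Fin n | G.Adj v u} : ℝ) ≤ 2 * Real.sqrt n * Real.log n)
    (S : Finset (Fin n)) (hS : S.Nonempty) :
    (Set.ncard {i : Fin n |
        i ∉ S ∧ steinerSize G (insert i S) = steinerSize G S + 1} : ℝ) ≤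
      (4 * S.card * Real.log n) ^ (4 * S.card) * Real.sqrt n := by
  classical
  have hG : ∀ u v : Fin n, u ≠ v → ∃ w, G.Adj u w ∧ G.Adj v w := fun u v h =>
    (Set.nonempty_of_ncard_ne_zero (Nat.one_le_iff_ne_zero.1 (hcommon u v h).1))
  set B := {i : Fin n | i ∉ S ∧ steinerSize G (insert i S) = steinerSize G S + 1}
  have hlog0 : 0 ≤ Real.log n := Real.log_natCast_nonneg n
  rcases B.eq_empty_or_nonempty with hE | ⟨i, hi⟩
  · rw [hE]
    simp only [Set.ncard_empty, Nat.cast_zero]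
    positivity
  obtain ⟨v, hv⟩ := hS
  have hL : 1 ≤ Real.log n :=
    one_le_log_of_common_neighbor G hG (u := i) (v := v) fun h => hi.1 (h ▸ hv)
  have hS : S.Nonempty := ⟨v, hv⟩
  have hs : 1 ≤ S.card := hS.card_pos
  have hs' : (1 : ℝ) ≤ S.card := by exact_mod_cast hs
  have hn : 1 ≤ Real.sqrt n := by
    rw [Real.one_le_sqrt]
    exact_mod_cast (Fin.pos i)
  set L := Real.log n
  set s : ℝ := (S.card : ℝ) with hsdef
  set X : ℝ := 4 * s * L with hX
  have hX4 : 4 ≤ X := by nlinarith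
  have hsX : 4 * s ≤ X := by nlinarith
  have hcount : ((percolationSets G S S.card).card : ℝ) ≤ (X ^ 2 / 2) ^ S.card := by
    refine card_percolationSets_le G S (m := S.card) (fun C hC => ?_) le_rfl
    have hC' : (C.card : ℝ) ≤ 2 * s := by
      rw [hsdef]; exact_mod_cast (by omega : C.card ≤ 2 * S.card)
    have h1 := card_doublyAttached_le G (fun u v h => (hcommon u v h).2) (sq_nonneg L) C
    have h2 : (C.card : ℝ) ^ 2 * L ^ 2 ≤ (2 * s) ^ 2 * L ^ 2 := by gcongr
    have h3 : (2 * s) ^ 2 * L ^ 2 = X ^ 2 / 4 := by rw [hX]; ring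
    nlinarith
  let N : Finset (Fin n) → Finset (Fin n) := fun C =>
    C.biUnion fun v => insert v ({u | G.Adj v u} : Finset (Fin n))
  have hN : ∀ C ∈ percolationSets G S S.card, ((N C).card : ℝ) ≤ 2 * X * Real.sqrt n := by
    intro C hC
    have hC' : (C.card : ℝ) ≤ 2 * s := by
      have := card_le_of_mem_percolationSets G S hC
      rw [hsdef]; exact_mod_cast (by omega : C.card ≤ 2 * S.card)
    refine (card_union_neighbors_le G hdeg C).trans ?_
    have h1 : 1 ≤ Real.sqrt n * L := by nlinarith
    calc (C.card : ℝ) * (2 * Real.sqrt n * L + 1) ≤ 2 * s * (3 * (Real.sqrt n * L)) := by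
          gcongr; linarith
      _ ≤ 2 * s * (4 * (Real.sqrt n * L)) := by gcongr; norm_num
      _ = 2 * X * Real.sqrt n := by rw [hX]; ring
  have hsub : B ⊆ ((percolationSets G S S.card).biUnion N : Finset (Fin n)) := by
    intro j hj
    obtain ⟨C, hC, v, hv, hvj⟩ := exists_percolationSet_near G hG hS hj.2
    refine Finset.mem_coe.2 (Finset.mem_biUnion.2 ⟨C, hC, Finset.mem_biUnion.2 ⟨v, hv, ?_⟩⟩)
    simpa using hvj
  have hcard : (B.ncard : ℝ) ≤ ∑ C ∈ percolationSets G S S.card, ((N C).card : ℝ) := by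
    have := Set.ncard_le_ncard hsub (Finset.finite_toSet _)
    rw [Set.ncard_coe_finset] at this
    exact_mod_cast this.trans Finset.card_biUnion_le
  have hpow : (2 : ℝ) ≤ 2 ^ S.card := le_self_pow₀ one_le_two (by omega)
  calc (B.ncard : ℝ) ≤ ∑ C ∈ percolationSets G S S.card, ((N C).card : ℝ) := hcard
    _ ≤ (percolationSets G S S.card).card * (2 * X * Real.sqrt n) := by
        rw [← nsmul_eq_mul]
        exact Finset.sum_le_card_nsmul _ _ _ hN
    _ ≤ (X ^ 2 / 2) ^ S.card * (2 * X * Real.sqrt n) := by gcongr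
    _ = X ^ (2 * S.card + 1) * Real.sqrt n * (2 / 2 ^ S.card) := by
        rw [div_pow, ← pow_mul]; ring
    _ ≤ X ^ (2 * S.card + 1) * Real.sqrt n :=
        mul_le_of_le_one_right (by positivity) ((div_le_one (by positivity)).2 hpow)
    _ ≤ X ^ (4 * S.card) * Real.sqrt n := by
        gcongr
        · linarith
        · omega
end

section
/- Let C ⊆ F_q^K be a q-ary linear code, let Φ be a Max K-CSP(C) instance with m = βn constraints on n variables (β a positive integer), and suppose Φ admits a perfect r-round Lasserre CSP vector solution, i.e., vectors V_{(S,α)} for all S ⊆ [n] with |S| ≤ r and α : S → F_q satisfying: (1) Σ_{i=1}^{m} Σ_{α : T_i → F_q} C_i(α)·‖V_{(T_i,α)}‖² = m; (2) ⟨V_{(S₁,α₁)}, V_{(S₂,α₂)}⟩ ≥ 0 for all S₁,S₂,α₁,α₂; (3) ⟨V_{(S₁,α₁)}, V_{(S₂,α₂)}⟩ = 0 whenever α₁ and α₂ disagree on S₁ ∩ S₂; (4) ⟨V_{(S₁,α₁)}, V_{(S₂,α₂)}⟩ = ⟨V_{(S₃,α₃)}, V_{(S₄,α₄)}⟩ whenever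 S₁∪S₂ = S₃∪S₄ and α₁∘α₂ = α₃∘α₄; (5) ‖V_{(∅,∅)}‖² = 1 and Σ_{j∈F_q} ‖V_{({i},{x_i→j})}‖² = 1 for all i. Then, with k = 2m, the graph G'_Φ admits vectors U_S for all vertex sets S with |S| ≤ r/K satisfying the Lasserre constraints for Densest k-subgraph, with objective value Σ_{(u,v)∈E(G'_Φ)} ‖U_{{u,v}}‖² = β·m·K. -/
open scoped RealInnerProductSpace

/-- A partial assignment of values in `F` to the variables `x_1, …, x_n`:
`α i = some a` means variable `i` is assigned value `a`, and `α i = none` means `i` is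
outside the domain. -/
abbrev PartialAsgn (n : ℕ) (F : Type) := Fin n → Option F

open Classical in
/-- The size of the domain of a partial assignment. -/
noncomputable def domCard {n : ℕ} {F : Type} (α : PartialAsgn n F) : ℕ :=
  (Finset.univ.filter fun i => (α i).isSome).card

open Classical in
/-- The partial assignment with domain the variables occurring in the tuple `T`,
assigning to `T j` the value `a j`. -/
noncomputable def tupleAsgn {n K : ℕ} {F : Type} (T : Fin K → Fin n) (a : Fin K → F) :
    PartialAsgn n F :=
  fun v => if h : ∃ j : Fin K, T j = v then some (a h.choose) else none

/-- Adjacency in the graph `G'_Φ` built from a Max K-CSP(C) instance `Φ`: left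
vertices are pairs `(Cᵢ, α)` with `α` a satisfying assignment for `Cᵢ`, right vertices
are `β` copies of the pairs `(x_j, a)`, and `(Cᵢ, α)` is joined to a copy of `(x_j, a)`
iff `x_j` occurs in `Cᵢ`'s tuple and `α(x_j) = a`. Only ordered left–right pairs are
related, so each edge is counted once. -/
def gPhiAdj (n K M β : ℕ) (F : Type) [Field F]
    (Ccode : Set (Fin K → F))
    (Φ : Fin M → ({T : Fin K → Fin n // Function.Injective T} × (Fin K → F)))
    (u w : (Fin M × (Fin K → F)) ⊕ (Fin n × F × Fin β)) : Prop :=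
  match u, w with
  | Sum.inl p, Sum.inr r =>
      ((fun j => p.2 j + (Φ p.1).2 j) ∈ Ccode) ∧
      ∃ j : Fin K, (Φ p.1).1.1 j = r.1 ∧ p.2 j = r.2.1
  | _, _ => False

/-- A vertex of the ambient type is an actual vertex of `G'_Φ` iff it is a right
vertex, or a left pair `(Cᵢ, α)` whose assignment satisfies `Cᵢ`. -/
def gPhiVert (n K M β : ℕ) (F : Type) [Field F]
    (Ccode : Set (Fin K → F))
    (Φ : Fin M → ({T : Fin K → Fin n // Function.Injective T} × (Fin K → F)))
    (u : (Fin M × (Fin K → F)) ⊕ (Fin n × F × Fin β)) : Prop :=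
  match u with
  | Sum.inl p => (fun j => p.2 j + (Φ p.1).2 j) ∈ Ccode
  | Sum.inr _ => True

section Resolution

variable {E ι : Type*} [NormedAddCommGroup E] [InnerProductSpace ℝ E]

lemma norm_sub_sum_sq_of_orthogonal (s : Finset ι) (v : ι → E) (e : E)
    (horth : ∀ i ∈ s, ∀ j ∈ s, i ≠ j → ⟪v i, v j⟫ = 0)
    (hproj : ∀ i ∈ s, ⟪e, v i⟫ = ‖v i‖ ^ 2) :
    ‖e - ∑ i ∈ s, v i‖ ^ 2 = ‖e‖ ^ 2 - ∑ i ∈ s, ‖v i‖ ^ 2 := by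
  have hcross : ⟪e, ∑ i ∈ s, v i⟫ = ∑ i ∈ s, ‖v i‖ ^ 2 := by
    rw [inner_sum]
    exact Finset.sum_congr rfl hproj
  have hself : ‖∑ i ∈ s, v i‖ ^ 2 = ∑ i ∈ s, ‖v i‖ ^ 2 := by
    rw [← real_inner_self_eq_norm_sq, sum_inner]
    refine Finset.sum_congr rfl fun i hi => ?_
    rw [inner_sum, Finset.sum_eq_single_of_mem i hi fun j hj hji => horth i hi j hj hji.symm,
      real_inner_self_eq_norm_sq]
  rw [norm_sub_sq_real, hcross, hself]
  ring

lemma sum_norm_sq_le_of_orthogonal (s : Finset ι) (v : ι → E) (e : E)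
    (horth : ∀ i ∈ s, ∀ j ∈ s, i ≠ j → ⟪v i, v j⟫ = 0)
    (hproj : ∀ i ∈ s, ⟪e, v i⟫ = ‖v i‖ ^ 2) :
    ∑ i ∈ s, ‖v i‖ ^ 2 ≤ ‖e‖ ^ 2 := by
  have h := norm_sub_sum_sq_of_orthogonal s v e horth hproj
  nlinarith [sq_nonneg ‖e - ∑ i ∈ s, v i‖]

lemma sum_eq_of_sum_norm_sq_eq (s : Finset ι) (v : ι → E) (e : E)
    (horth : ∀ i ∈ s, ∀ j ∈ s, i ≠ j → ⟪v i, v j⟫ = 0)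
    (hproj : ∀ i ∈ s, ⟪e, v i⟫ = ‖v i‖ ^ 2)
    (hsum : ∑ i ∈ s, ‖v i‖ ^ 2 = ‖e‖ ^ 2) :
    ∑ i ∈ s, v i = e := by
  have h := norm_sub_sum_sq_of_orthogonal s v e horth hproj
  rw [hsum, sub_self, sq_eq_zero_iff, norm_eq_zero, sub_eq_zero] at h
  exact h.symm

end Resolution

section Merge

variable {n : ℕ} {F : Type} {ι : Type*}

/-- The family `f` of partial assignments is pairwise consistent on `S`. -/
def Compatible (f : ι → PartialAsgn n F) (S : Finset ι) : Prop :=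
  ∀ u ∈ S, ∀ w ∈ S, ∀ i a b, f u i = some a → f w i = some b → a = b

open Classical in
/-- The common extension of the partial assignments `f u`, `u ∈ S`. -/
noncomputable def mergeAsgn (f : ι → PartialAsgn n F) (S : Finset ι) : PartialAsgn n F :=
  fun i => if h : ∃ a, ∃ u ∈ S, f u i = some a then some h.choose else none

open Classical in
/-- The vector of the merged assignment of `S`, or zero if `S` is inconsistent. -/
noncomputable def mergeVec {E : Type*} [Zero E] (V : PartialAsgn n F → E)
    (f : ι → PartialAsgn n F) (S : Finset ι) : E :=
  if Compatible f S then V (mergeAsgn f S) else 0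

lemma Compatible.mono {f : ι → PartialAsgn n F} {S T : Finset ι} (h : Compatible f T)
    (hST : S ⊆ T) : Compatible f S :=
  fun u hu w hw => h u (hST hu) w (hST hw)

lemma Compatible.mergeAsgn_eq_some_iff {f : ι → PartialAsgn n F} {S : Finset ι}
    (h : Compatible f S) (i : Fin n) (a : F) :
    mergeAsgn f S i = some a ↔ ∃ u ∈ S, f u i = some a := by
  unfold mergeAsgn
  split_ifs with hex
  · obtain ⟨u, hu, hfu⟩ := hex.choose_spec
    constructor
    · intro ha
      exact ⟨u, hu, hfu.trans ha⟩
    · rintro ⟨w, hw, hfw⟩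
      rw [h u hu w hw i _ _ hfu hfw]
  · simp only [false_iff]
    exact fun hu => hex ⟨a, hu⟩

lemma Compatible.elim_mergeAsgn [DecidableEq ι] {f : ι → PartialAsgn n F} {S T : Finset ι}
    (h : Compatible f (S ∪ T)) :
    (fun i => (mergeAsgn f S i).elim (mergeAsgn f T i) some) = mergeAsgn f (S ∪ T) := by
  have hS := h.mono Finset.subset_union_left
  have hT := h.mono Finset.subset_union_right
  funext i
  cases hi : mergeAsgn f S i with
  | some a =>
    obtain ⟨u, hu, hfu⟩ := (hS.mergeAsgn_eq_some_iff i a).1 hi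
    exact ((h.mergeAsgn_eq_some_iff i a).2 ⟨u, Finset.mem_union_left _ hu, hfu⟩).symm
  | none =>
    refine Option.ext fun a => ?_
    rw [Option.elim_none, hT.mergeAsgn_eq_some_iff, h.mergeAsgn_eq_some_iff]
    constructor
    · rintro ⟨u, hu, hfu⟩
      exact ⟨u, Finset.mem_union_right _ hu, hfu⟩
    · rintro ⟨u, hu, hfu⟩
      rcases Finset.mem_union.1 hu with hu | hu
      · rw [(hS.mergeAsgn_eq_some_iff i a).2 ⟨u, hu, hfu⟩] at hi
        cases hi
      · exact ⟨u, hu, hfu⟩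

lemma compatible_singleton (f : ι → PartialAsgn n F) (u : ι) : Compatible f {u} := by
  simp only [Compatible, Finset.mem_singleton, forall_eq]
  intro i a b ha hb
  exact Option.some_injective _ (ha.symm.trans hb)

lemma mergeAsgn_singleton (f : ι → PartialAsgn n F) (u : ι) : mergeAsgn f {u} = f u := by
  funext i
  refine Option.ext fun a => ?_
  simp [(compatible_singleton f u).mergeAsgn_eq_some_iff]

lemma mergeVec_singleton {E : Type*} [Zero E] (V : PartialAsgn n F → E)
    (f : ι → PartialAsgn n F) (u : ι) : mergeVec V f {u} = V (f u) := by
  rw [mergeVec, if_pos (compatible_singleton f u), mergeAsgn_singleton]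

lemma mergeVec_empty {E : Type*} [Zero E] (V : PartialAsgn n F → E)
    (f : ι → PartialAsgn n F) : mergeVec V f ∅ = V fun _ => none := by
  rw [mergeVec, if_pos (by simp [Compatible])]
  congr 1
  funext i
  simp [mergeAsgn]

lemma mergeVec_pair_of_le {E : Type*} [Zero E] [DecidableEq ι] (V : PartialAsgn n F → E)
    (f : ι → PartialAsgn n F) (u w : ι)
    (hle : ∀ i a, f w i = some a → f u i = some a) : mergeVec V f {u, w} = V (f u) := by
  have hle' : ∀ x ∈ ({u, w} : Finset ι), ∀ i a, f x i = some a → f u i = some a := by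
    intro x hx i a ha
    rcases Finset.mem_insert.1 hx with rfl | hx
    · exact ha
    · rw [Finset.mem_singleton.1 hx] at ha
      exact hle i a ha
  have hc : Compatible f {u, w} := fun x hx y hy i a b ha hb =>
    Option.some_injective _ ((hle' x hx i a ha).symm.trans (hle' y hy i b hb))
  rw [mergeVec, if_pos hc]
  congr 1
  funext i
  refine Option.ext fun a => ?_
  rw [hc.mergeAsgn_eq_some_iff]
  exact ⟨fun ⟨x, hx, ha⟩ => hle' x hx i a ha, fun ha => ⟨u, Finset.mem_insert_self _ _, ha⟩⟩

lemma domCard_mergeAsgn_le (f : ι → PartialAsgn n F) (S : Finset ι) (K : ℕ)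
    (hf : ∀ u ∈ S, domCard (f u) ≤ K) : domCard (mergeAsgn f S) ≤ S.card * K := by
  classical
  refine le_trans (Finset.card_le_card (t := S.biUnion fun u =>
    Finset.univ.filter fun i => (f u i).isSome) fun i hi => ?_)
    (Finset.card_biUnion_le_card_mul S _ K fun u hu => ?_)
  · simp only [Finset.mem_filter, Finset.mem_univ, true_and, Finset.mem_biUnion] at hi ⊢
    unfold mergeAsgn at hi
    split_ifs at hi with h
    · obtain ⟨a, u, hu, ha⟩ := h
      exact ⟨u, hu, by simp [ha]⟩
    · simp at hi
  · convert hf u hu using 1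
    unfold domCard
    congr

section Inner

variable {E : Type*} [NormedAddCommGroup E] [InnerProductSpace ℝ E]
  {V : PartialAsgn n F → E} {f : ι → PartialAsgn n F} {r : ℕ}

lemma inner_mergeVec_nonneg
    (hnonneg : ∀ α₁ α₂ : PartialAsgn n F, domCard α₁ ≤ r → domCard α₂ ≤ r → 0 ≤ ⟪V α₁, V α₂⟫)
    {S T : Finset ι} (hS : domCard (mergeAsgn f S) ≤ r) (hT : domCard (mergeAsgn f T) ≤ r) :
    0 ≤ ⟪mergeVec V f S, mergeVec V f T⟫ := by
  unfold mergeVec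
  split_ifs <;> simp [hnonneg _ _ hS hT]

lemma inner_mergeVec_of_not_compatible [DecidableEq ι]
    (horth : ∀ α₁ α₂ : PartialAsgn n F, domCard α₁ ≤ r → domCard α₂ ≤ r →
      (∃ (i : Fin n) (a b : F), α₁ i = some a ∧ α₂ i = some b ∧ a ≠ b) → ⟪V α₁, V α₂⟫ = 0)
    {S T : Finset ι} (hS : domCard (mergeAsgn f S) ≤ r) (hT : domCard (mergeAsgn f T) ≤ r)
    (h : ¬ Compatible f (S ∪ T)) : ⟪mergeVec V f S, mergeVec V f T⟫ = 0 := by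
  by_cases cS : Compatible f S
  swap
  · simp [mergeVec, cS]
  by_cases cT : Compatible f T
  swap
  · simp [mergeVec, cT]
  rw [mergeVec, mergeVec, if_pos cS, if_pos cT]
  refine horth _ _ hS hT ?_
  unfold Compatible at h
  push Not at h
  obtain ⟨u, hu, w, hw, i, a, b, ha, hb, hab⟩ := h
  rcases Finset.mem_union.1 hu with hu | hu <;> rcases Finset.mem_union.1 hw with hw | hw
  · exact absurd (cS u hu w hw i a b ha hb) hab
  · exact ⟨i, a, b, (cS.mergeAsgn_eq_some_iff i a).2 ⟨u, hu, ha⟩,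
      (cT.mergeAsgn_eq_some_iff i b).2 ⟨w, hw, hb⟩, hab⟩
  · exact ⟨i, b, a, (cS.mergeAsgn_eq_some_iff i b).2 ⟨w, hw, hb⟩,
      (cT.mergeAsgn_eq_some_iff i a).2 ⟨u, hu, ha⟩, hab.symm⟩
  · exact absurd (cT u hu w hw i a b ha hb) hab

lemma Compatible.mergeAsgn_agree [DecidableEq ι] {S T : Finset ι} (h : Compatible f (S ∪ T))
    (i : Fin n) (a b : F) (ha : mergeAsgn f S i = some a) (hb : mergeAsgn f T i = some b) :
    a = b := by
  obtain ⟨u, hu, hfu⟩ :=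
    ((h.mono Finset.subset_union_left).mergeAsgn_eq_some_iff i a).1 ha
  obtain ⟨w, hw, hfw⟩ :=
    ((h.mono Finset.subset_union_right).mergeAsgn_eq_some_iff i b).1 hb
  exact h u (Finset.mem_union_left _ hu) w (Finset.mem_union_right _ hw) i a b hfu hfw

lemma inner_mergeVec_eq_of_union_eq [DecidableEq ι]
    (horth : ∀ α₁ α₂ : PartialAsgn n F, domCard α₁ ≤ r → domCard α₂ ≤ r →
      (∃ (i : Fin n) (a b : F), α₁ i = some a ∧ α₂ i = some b ∧ a ≠ b) → ⟪V α₁, V α₂⟫ = 0)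
    (hmerge : ∀ α₁ α₂ α₃ α₄ : PartialAsgn n F,
      domCard α₁ ≤ r → domCard α₂ ≤ r → domCard α₃ ≤ r → domCard α₄ ≤ r →
      (∀ (i : Fin n) (a b : F), α₁ i = some a → α₂ i = some b → a = b) →
      (∀ (i : Fin n) (a b : F), α₃ i = some a → α₄ i = some b → a = b) →
      (fun i => (α₁ i).elim (α₂ i) some) = (fun i => (α₃ i).elim (α₄ i) some) →
      ⟪V α₁, V α₂⟫ = ⟪V α₃, V α₄⟫)
    {S₁ S₂ S₃ S₄ : Finset ι}
    (hS₁ : domCard (mergeAsgn f S₁) ≤ r) (hS₂ : domCard (mergeAsgn f S₂) ≤ r)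
    (hS₃ : domCard (mergeAsgn f S₃) ≤ r) (hS₄ : domCard (mergeAsgn f S₄) ≤ r)
    (h : S₁ ∪ S₂ = S₃ ∪ S₄) :
    ⟪mergeVec V f S₁, mergeVec V f S₂⟫ = ⟪mergeVec V f S₃, mergeVec V f S₄⟫ := by
  by_cases c : Compatible f (S₁ ∪ S₂)
  · have c' : Compatible f (S₃ ∪ S₄) := h ▸ c
    unfold mergeVec
    rw [if_pos (c.mono Finset.subset_union_left), if_pos (c.mono Finset.subset_union_right),
      if_pos (c'.mono Finset.subset_union_left), if_pos (c'.mono Finset.subset_union_right)]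
    refine hmerge _ _ _ _ hS₁ hS₂ hS₃ hS₄ c.mergeAsgn_agree c'.mergeAsgn_agree ?_
    rw [c.elim_mergeAsgn, c'.elim_mergeAsgn, h]
  · rw [inner_mergeVec_of_not_compatible horth hS₁ hS₂ c,
      inner_mergeVec_of_not_compatible horth hS₃ hS₄ (h ▸ c)]

end Inner

end Merge

section Vertices

variable {n K M β : ℕ} {F : Type}

lemma tupleAsgn_eq_some_iff {T : Fin K → Fin n} (hT : Function.Injective T) (a : Fin K → F)
    (v : Fin n) (b : F) : tupleAsgn T a v = some b ↔ ∃ j, T j = v ∧ a j = b := by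
  unfold tupleAsgn
  split_ifs with h
  · constructor
    · intro hb
      exact ⟨_, h.choose_spec, Option.some_injective _ hb⟩
    · rintro ⟨j, hj, rfl⟩
      rw [hT (h.choose_spec.trans hj.symm)]
  · simp only [false_iff]
    rintro ⟨j, hj, -⟩
    exact h ⟨j, hj⟩

lemma domCard_tupleAsgn_le (T : Fin K → Fin n) (a : Fin K → F) :
    domCard (tupleAsgn T a) ≤ K := by
  classical
  unfold domCard
  refine le_trans (Finset.card_le_card (t := Finset.univ.image T) fun v hv => ?_)
    (Finset.card_image_le.trans_eq (by simp))
  have hsome := (Finset.mem_filter.1 hv).2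
  unfold tupleAsgn at hsome
  split_ifs at hsome with h
  · simpa using h
  · simp at hsome

lemma domCard_single_le (x : Fin n) (a : F) :
    domCard (fun v => if v = x then some a else none) ≤ 1 := by
  unfold domCard
  refine (Finset.card_le_card (t := {x}) fun v hv => ?_).trans_eq (Finset.card_singleton x)
  simpa [ite_eq_iff] using hv

lemma domCard_none : domCard (fun _ => none : PartialAsgn n F) = 0 := by
  simp [domCard]

/-- The partial assignment carried by a vertex of `G'_Φ`. -/
noncomputable def vertexAsgn
    (Φ : Fin M → ({T : Fin K → Fin n // Function.Injective T} × (Fin K → F)))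
    (u : (Fin M × (Fin K → F)) ⊕ (Fin n × F × Fin β)) : PartialAsgn n F :=
  match u with
  | Sum.inl p => tupleAsgn (Φ p.1).1.1 p.2
  | Sum.inr x => fun v => if v = x.1 then some x.2.1 else none

lemma domCard_vertexAsgn_le (hK : 0 < K)
    (Φ : Fin M → ({T : Fin K → Fin n // Function.Injective T} × (Fin K → F)))
    (u : (Fin M × (Fin K → F)) ⊕ (Fin n × F × Fin β)) :
    domCard (vertexAsgn Φ u) ≤ K := by
  match u with
  | Sum.inl p => exact domCard_tupleAsgn_le _ _
  | Sum.inr x => exact (domCard_single_le _ _).trans hK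

open Classical in
lemma card_tuple_edges [Fintype F] {T : Fin K → Fin n} (hT : Function.Injective T)
    (a : Fin K → F) :
    (Finset.univ.filter fun x : Fin n × F × Fin β => ∃ j, T j = x.1 ∧ a j = x.2.1).card
      = K * β := by
  have himage : (Finset.univ.filter fun x : Fin n × F × Fin β => ∃ j, T j = x.1 ∧ a j = x.2.1)
      = Finset.univ.image fun y : Fin K × Fin β => (T y.1, a y.1, y.2) := by
    ext ⟨v, b, c⟩
    simp
  rw [himage, Finset.card_image_of_injective]
  · simp
  · rintro ⟨j, c⟩ ⟨j', c'⟩ h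
    simp only [Prod.mk.injEq] at h
    rw [hT h.1, h.2.2]

end Vertices

lemma mergeVec_pair_of_gPhiAdj {n K M β : ℕ} {F : Type} [Field F] [DecidableEq F]
    {E : Type*} [Zero E] {V : PartialAsgn n F → E} (Ccode : Set (Fin K → F))
    (Φ : Fin M → ({T : Fin K → Fin n // Function.Injective T} × (Fin K → F)))
    (p : Fin M × (Fin K → F)) (x : Fin n × F × Fin β)
    (h : gPhiAdj n K M β F Ccode Φ (Sum.inl p) (Sum.inr x)) :
    mergeVec V (vertexAsgn Φ) {Sum.inl p, Sum.inr x} = V (tupleAsgn (Φ p.1).1.1 p.2) := by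
  refine mergeVec_pair_of_le V _ _ _ fun i a ha => ?_
  obtain ⟨-, j, hj, hja⟩ := h
  simp only [vertexAsgn] at ha ⊢
  split_ifs at ha with hi
  rw [tupleAsgn_eq_some_iff (Φ p.1).1.2]
  exact ⟨j, hj.trans hi.symm, hja.trans (Option.some_injective _ ha)⟩

section Objective

variable {n K M β : ℕ} {F : Type} [Field F] [Fintype F]

open Classical in
lemma sum_edges_norm_sq {E : Type*} [NormedAddCommGroup E]
    (Ccode : Set (Fin K → F))
    (Φ : Fin M → ({T : Fin K → Fin n // Function.Injective T} × (Fin K → F)))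
    (V : PartialAsgn n F → E)
    (U : (Fin M × (Fin K → F)) → (Fin n × F × Fin β) → E)
    (hU : ∀ p x, gPhiAdj n K M β F Ccode Φ (Sum.inl p) (Sum.inr x) →
      U p x = V (tupleAsgn (Φ p.1).1.1 p.2)) :
    (∑ p : Fin M × (Fin K → F), ∑ x : Fin n × F × Fin β,
      if gPhiAdj n K M β F Ccode Φ (Sum.inl p) (Sum.inr x) then ‖U p x‖ ^ 2 else 0) =
    β * (∑ i : Fin M, ∑ a : Fin K → F,
      if (fun j => a j + (Φ i).2 j) ∈ Ccode then ‖V (tupleAsgn (Φ i).1.1 a)‖ ^ 2 else 0) * K := by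
  have hinner : ∀ p : Fin M × (Fin K → F), (∑ x : Fin n × F × Fin β,
      if gPhiAdj n K M β F Ccode Φ (Sum.inl p) (Sum.inr x) then ‖U p x‖ ^ 2 else 0) =
      β * (if (fun j => p.2 j + (Φ p.1).2 j) ∈ Ccode then
        ‖V (tupleAsgn (Φ p.1).1.1 p.2)‖ ^ 2 else 0) * K := by
    intro p
    have hrw : ∀ x : Fin n × F × Fin β,
        (if gPhiAdj n K M β F Ccode Φ (Sum.inl p) (Sum.inr x) then ‖U p x‖ ^ 2 else 0) =
        if ∃ j, (Φ p.1).1.1 j = x.1 ∧ p.2 j = x.2.1 then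
          (if (fun j => p.2 j + (Φ p.1).2 j) ∈ Ccode then
            ‖V (tupleAsgn (Φ p.1).1.1 p.2)‖ ^ 2 else 0) else 0 := by
      intro x
      by_cases hadj : gPhiAdj n K M β F Ccode Φ (Sum.inl p) (Sum.inr x)
      · rw [if_pos hadj, hU p x hadj, if_pos hadj.2, if_pos hadj.1]
      · rw [if_neg hadj]
        split_ifs with hj hc
        · exact absurd ⟨hc, hj⟩ hadj
        · rfl
        · rfl
    rw [Finset.sum_congr rfl fun x _ => hrw x, ← Finset.sum_filter, Finset.sum_const,
      card_tuple_edges (Φ p.1).1.2, nsmul_eq_mul]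
    push_cast
    ring
  rw [Finset.sum_congr rfl fun p _ => hinner p, ← Finset.sum_mul, ← Finset.mul_sum,
    Fintype.sum_prod_type]

end Objective

section Completeness

variable {n K M r : ℕ} {F : Type}
  {E : Type*} [NormedAddCommGroup E] [InnerProductSpace ℝ E] {V : PartialAsgn n F → E}

lemma inner_none_eq_norm_sq
    (hmerge : ∀ α₁ α₂ α₃ α₄ : PartialAsgn n F,
      domCard α₁ ≤ r → domCard α₂ ≤ r → domCard α₃ ≤ r → domCard α₄ ≤ r →
      (∀ (i : Fin n) (a b : F), α₁ i = some a → α₂ i = some b → a = b) →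
      (∀ (i : Fin n) (a b : F), α₃ i = some a → α₄ i = some b → a = b) →
      (fun i => (α₁ i).elim (α₂ i) some) = (fun i => (α₃ i).elim (α₄ i) some) →
      ⟪V α₁, V α₂⟫ = ⟪V α₃, V α₄⟫)
    (γ : PartialAsgn n F) (hγ : domCard γ ≤ r) : ⟪V fun _ => none, V γ⟫ = ‖V γ‖ ^ 2 := by
  rw [← real_inner_self_eq_norm_sq]
  refine hmerge _ _ _ _ (domCard_none.trans_le (Nat.zero_le r)) hγ hγ hγ (by simp) ?_ ?_
  · intro i a b ha hb
    exact Option.some_injective _ (ha.symm.trans hb)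
  · funext i
    cases γ i <;> rfl

lemma sum_single_eq [Fintype F] (hr : 1 ≤ r)
    (horth : ∀ α₁ α₂ : PartialAsgn n F, domCard α₁ ≤ r → domCard α₂ ≤ r →
      (∃ (i : Fin n) (a b : F), α₁ i = some a ∧ α₂ i = some b ∧ a ≠ b) → ⟪V α₁, V α₂⟫ = 0)
    (hproj : ∀ γ : PartialAsgn n F, domCard γ ≤ r → ⟪V fun _ => none, V γ⟫ = ‖V γ‖ ^ 2)
    (hnone : ‖V (fun _ => none)‖ ^ 2 = 1) (i : Fin n)
    (hsum : (∑ j : F, ‖V (fun v => if v = i then some j else none)‖ ^ 2) = 1) :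
    ∑ j : F, V (fun v => if v = i then some j else none) = V fun _ => none := by
  refine sum_eq_of_sum_norm_sq_eq _ _ _ (fun a _ b _ hab => ?_)
    (fun a _ => hproj _ ((domCard_single_le i a).trans hr)) (hsum.trans hnone.symm)
  exact horth _ _ ((domCard_single_le i a).trans hr) ((domCard_single_le i b).trans hr)
    ⟨i, a, b, by simp, by simp, hab⟩

open Classical in
lemma sum_satisfying_eq [Field F] [Fintype F] (hr : K ≤ r)
    (horth : ∀ α₁ α₂ : PartialAsgn n F, domCard α₁ ≤ r → domCard α₂ ≤ r →
      (∃ (i : Fin n) (a b : F), α₁ i = some a ∧ α₂ i = some b ∧ a ≠ b) → ⟪V α₁, V α₂⟫ = 0)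
    (hproj : ∀ γ : PartialAsgn n F, domCard γ ≤ r → ⟪V fun _ => none, V γ⟫ = ‖V γ‖ ^ 2)
    (hnone : ‖V (fun _ => none)‖ ^ 2 = 1)
    (Ccode : Set (Fin K → F))
    (Φ : Fin M → ({T : Fin K → Fin n // Function.Injective T} × (Fin K → F)))
    (hperfect : (∑ i : Fin M, ∑ a : Fin K → F,
      if (fun j => a j + (Φ i).2 j) ∈ Ccode then
        ‖V (tupleAsgn (Φ i).1.1 a)‖ ^ 2 else 0) = (M : ℝ)) (i : Fin M) :
    ∑ a : Fin K → F with (fun j => a j + (Φ i).2 j) ∈ Ccode, V (tupleAsgn (Φ i).1.1 a)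
      = V fun _ => none := by
  have hdom : ∀ (i : Fin M) (a : Fin K → F), domCard (tupleAsgn (Φ i).1.1 a) ≤ r :=
    fun i a => (domCard_tupleAsgn_le _ a).trans hr
  have hpair : ∀ (i : Fin M) (a b : Fin K → F), a ≠ b →
      ⟪V (tupleAsgn (Φ i).1.1 a), V (tupleAsgn (Φ i).1.1 b)⟫ = 0 := by
    intro i a b hab
    obtain ⟨j, hj⟩ := Function.ne_iff.1 hab
    exact horth _ _ (hdom i a) (hdom i b) ⟨(Φ i).1.1 j, a j, b j,
      (tupleAsgn_eq_some_iff (Φ i).1.2 _ _ _).2 ⟨j, rfl, rfl⟩,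
      (tupleAsgn_eq_some_iff (Φ i).1.2 _ _ _).2 ⟨j, rfl, rfl⟩, hj⟩
  simp only [← Finset.sum_filter] at hperfect
  have hle : ∀ i ∈ (Finset.univ : Finset (Fin M)),
      (∑ a : Fin K → F with (fun j => a j + (Φ i).2 j) ∈ Ccode,
        ‖V (tupleAsgn (Φ i).1.1 a)‖ ^ 2) ≤ 1 := fun i _ =>
    (sum_norm_sq_le_of_orthogonal _ _ _ (fun a _ b _ hab => hpair i a b hab)
      (fun a _ => hproj _ (hdom i a))).trans_eq hnone
  have heq := (Finset.sum_eq_sum_iff_of_le hle).1 (by simpa using hperfect) i (Finset.mem_univ i)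
  exact sum_eq_of_sum_norm_sq_eq _ _ _ (fun a _ b _ hab => hpair i a b hab)
    (fun a _ => hproj _ (hdom i a)) (heq.trans hnone.symm)

end Completeness

open Classical in
/-- If a Max K-CSP(C) instance `Φ` with `m = βn` constraints admits a
perfect `r`-round Lasserre CSP vector solution `V`, then with `k = 2m` the graph
`G'_Φ` admits vectors `U_S` for all vertex sets `S` with `|S| ≤ r/K` satisfying the
Lasserre constraints for Densest `k`-subgraph, with objective value `β m K`. -/
theorem lasserre_completeness (F : Type) [Field F] [Fintype F] [DecidableEq F]
    (n K β r : ℕ) (hβpos : 0 < β)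
    (Ccode : Submodule F (Fin K → F))
    (Φ : Fin (β * n) → ({T : Fin K → Fin n // Function.Injective T} × (Fin K → F)))
    (N₀ : ℕ) (V : PartialAsgn n F → EuclideanSpace ℝ (Fin N₀))
    -- (1) perfect value
    (h1 : (∑ i : Fin (β * n), ∑ a : Fin K → F,
        if (fun j => a j + (Φ i).2 j) ∈ Ccode then
          ‖V (tupleAsgn (Φ i).1.1 a)‖ ^ 2 else 0) = ((β * n : ℕ) : ℝ))
    -- (2) nonnegative inner products
    (h2 : ∀ α₁ α₂ : PartialAsgn n F, domCard α₁ ≤ r → domCard α₂ ≤ r →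
      0 ≤ ⟪V α₁, V α₂⟫)
    -- (3) orthogonality of inconsistent assignments
    (h3 : ∀ α₁ α₂ : PartialAsgn n F, domCard α₁ ≤ r → domCard α₂ ≤ r →
      (∃ (i : Fin n) (a b : F), α₁ i = some a ∧ α₂ i = some b ∧ a ≠ b) →
      ⟪V α₁, V α₂⟫ = 0)
    -- (4) inner products depend only on the merged assignment
    (h4 : ∀ α₁ α₂ α₃ α₄ : PartialAsgn n F,
      domCard α₁ ≤ r → domCard α₂ ≤ r → domCard α₃ ≤ r → domCard α₄ ≤ r →
      (∀ (i : Fin n) (a b : F), α₁ i = some a → α₂ i = some b → a = b) →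
      (∀ (i : Fin n) (a b : F), α₃ i = some a → α₄ i = some b → a = b) →
      (fun i => (α₁ i).elim (α₂ i) some) = (fun i => (α₃ i).elim (α₄ i) some) →
      ⟪V α₁, V α₂⟫ = ⟪V α₃, V α₄⟫)
    -- (5) normalization
    (h5a : ‖V (fun _ => none)‖ ^ 2 = 1)
    (h5b : ∀ i : Fin n, (∑ j : F,
      ‖V (fun v => if v = i then some j else none)‖ ^ 2) = 1) :
    ∃ (N : ℕ)
      (U : Finset ((Fin (β * n) × (Fin K → F)) ⊕ (Fin n × F × Fin β)) →
        EuclideanSpace ℝ (Fin N)),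
      -- nonnegative inner products
      (∀ S₁ S₂, (∀ u ∈ S₁, gPhiVert n K (β * n) β F Ccode Φ u) →
        (∀ u ∈ S₂, gPhiVert n K (β * n) β F Ccode Φ u) →
        (S₁.card : ℝ) ≤ (r : ℝ) / (K : ℝ) → (S₂.card : ℝ) ≤ (r : ℝ) / (K : ℝ) →
        0 ≤ ⟪U S₁, U S₂⟫) ∧
      -- consistency on unions
      (∀ S₁ S₂ S₃ S₄, (∀ u ∈ S₁, gPhiVert n K (β * n) β F Ccode Φ u) →
        (∀ u ∈ S₂, gPhiVert n K (β * n) β F Ccode Φ u) →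
        (∀ u ∈ S₃, gPhiVert n K (β * n) β F Ccode Φ u) →
        (∀ u ∈ S₄, gPhiVert n K (β * n) β F Ccode Φ u) →
        (S₁.card : ℝ) ≤ (r : ℝ) / (K : ℝ) → (S₂.card : ℝ) ≤ (r : ℝ) / (K : ℝ) →
        (S₃.card : ℝ) ≤ (r : ℝ) / (K : ℝ) → (S₄.card : ℝ) ≤ (r : ℝ) / (K : ℝ) →
        S₁ ∪ S₂ = S₃ ∪ S₄ → ⟪U S₁, U S₂⟫ = ⟪U S₃, U S₄⟫) ∧
      -- size constraint with k = 2m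
      (∀ S, (∀ u ∈ S, gPhiVert n K (β * n) β F Ccode Φ u) →
        (S.card : ℝ) ≤ (r : ℝ) / (K : ℝ) →
        (∑ p : Fin (β * n) × (Fin K → F),
            if (fun j => p.2 j + (Φ p.1).2 j) ∈ Ccode then
              ⟪U {Sum.inl p}, U S⟫ else 0) +
          (∑ rv : Fin n × F × Fin β, ⟪U {Sum.inr rv}, U S⟫) ≤
          (2 * (β * n : ℕ) : ℝ) * ‖U S‖ ^ 2) ∧
      -- normalization
      ‖U ∅‖ ^ 2 = 1 ∧
      -- objective value β m K
      (∑ p : Fin (β * n) × (Fin K → F), ∑ rv : Fin n × F × Fin β,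
        if gPhiAdj n K (β * n) β F Ccode Φ (Sum.inl p) (Sum.inr rv) then
          ‖U {Sum.inl p, Sum.inr rv}‖ ^ 2 else 0) =
        (β : ℝ) * ((β * n : ℕ) : ℝ) * (K : ℝ) := by
  have hobj := fun U hU => (sum_edges_norm_sq (β := β) (Ccode : Set (Fin K → F)) Φ V U hU).trans
    (congrArg (fun t : ℝ => β * t * K) h1)
  by_cases hKr : 0 < K ∧ K ≤ r
  · obtain ⟨hK, hKr⟩ := hKr
    have hdom : ∀ S : Finset ((Fin (β * n) × (Fin K → F)) ⊕ (Fin n × F × Fin β)),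
        (S.card : ℝ) ≤ (r : ℝ) / (K : ℝ) → domCard (mergeAsgn (vertexAsgn Φ) S) ≤ r := by
      intro S hS
      rw [le_div_iff₀ (by exact_mod_cast hK)] at hS
      exact (domCard_mergeAsgn_le _ S K fun u _ => domCard_vertexAsgn_le hK Φ u).trans
        (by exact_mod_cast hS)
    have hproj := inner_none_eq_norm_sq h4
    refine ⟨N₀, mergeVec V (vertexAsgn Φ), ?_, ?_, ?_, ?_, ?_⟩
    · intro S₁ S₂ _ _ c₁ c₂
      exact inner_mergeVec_nonneg h2 (hdom _ c₁) (hdom _ c₂)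
    · intro S₁ S₂ S₃ S₄ _ _ _ _ c₁ c₂ c₃ c₄ h
      exact inner_mergeVec_eq_of_union_eq h3 h4 (hdom _ c₁) (hdom _ c₂) (hdom _ c₃) (hdom _ c₄) h
    · intro S _ hS
      have hself : ⟪V fun _ => none, mergeVec V (vertexAsgn Φ) S⟫ =
          ‖mergeVec V (vertexAsgn Φ) S‖ ^ 2 := by
        unfold mergeVec
        split_ifs
        · exact hproj _ (hdom S hS)
        · simp
      simp only [mergeVec_singleton, Fintype.sum_prod_type, vertexAsgn]
      have hleft : ∀ i : Fin (β * n), (∑ a : Fin K → F,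
          if (fun j => a j + (Φ i).2 j) ∈ Ccode then
            ⟪V (tupleAsgn (Φ i).1.1 a), mergeVec V (vertexAsgn Φ) S⟫ else 0) =
          ‖mergeVec V (vertexAsgn Φ) S‖ ^ 2 := by
        intro i
        rw [← Finset.sum_filter, ← sum_inner, ← hself]
        congr 1
        exact sum_satisfying_eq hKr h3 hproj h5a (Ccode : Set (Fin K → F)) Φ h1 i
      have hright : ∀ i : Fin n, (∑ a : F, ∑ _c : Fin β,
          ⟪V (fun v => if v = i then some a else none), mergeVec V (vertexAsgn Φ) S⟫) =
          β * ‖mergeVec V (vertexAsgn Φ) S‖ ^ 2 := by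
        intro i
        rw [Finset.sum_comm, Finset.sum_congr rfl fun c _ => (sum_inner _ _ _).symm,
          sum_single_eq (hK.trans_le hKr) h3 hproj h5a i (h5b i), hself]
        simp
      rw [Finset.sum_congr rfl fun i _ => hleft i, Finset.sum_congr rfl fun i _ => hright i]
      simp only [Finset.sum_const, Finset.card_univ, Fintype.card_fin, nsmul_eq_mul]
      push_cast
      exact le_of_eq (by ring)
    · rw [mergeVec_empty, h5a]
    · exact hobj _ fun p x h => mergeVec_pair_of_gPhiAdj _ Φ p x h
  · -- Only the empty set has at most `r / K` elements.
    have hempty : ∀ S : Finset ((Fin (β * n) × (Fin K → F)) ⊕ (Fin n × F × Fin β)),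
        (S.card : ℝ) ≤ (r : ℝ) / (K : ℝ) → S = ∅ := by
      intro S hS
      rw [← Finset.card_eq_zero]
      rcases Nat.eq_zero_or_pos K with hK | hK
      · simp only [hK, Nat.cast_zero, div_zero] at hS
        exact_mod_cast le_antisymm hS (Nat.cast_nonneg _)
      · rw [le_div_iff₀ (by exact_mod_cast hK)] at hS
        have hS' : S.card * K ≤ r := by exact_mod_cast hS
        by_contra hne
        have := Nat.le_mul_of_pos_left K (Nat.pos_of_ne_zero hne)
        exact hKr ⟨hK, this.trans hS'⟩
    refine ⟨N₀, fun S => if S.card = 1 then 0 else mergeVec V (vertexAsgn Φ) S,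
      ?_, ?_, ?_, ?_, ?_⟩
    · intro S₁ S₂ _ _ c₁ c₂
      rw [hempty _ c₁, hempty _ c₂]
      exact real_inner_self_nonneg
    · intro S₁ S₂ S₃ S₄ _ _ _ _ c₁ c₂ c₃ c₄ _
      rw [hempty _ c₁, hempty _ c₂, hempty _ c₃, hempty _ c₄]
    · intro S _ _
      simp only [Finset.card_singleton, if_true, inner_zero_left, ite_self, Finset.sum_const_zero,
        add_zero]
      positivity
    · simp [mergeVec_empty, h5a]
    · refine hobj (fun p x => if ({Sum.inl p, Sum.inr x} : Finset _).card = 1 then 0 else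
        mergeVec V (vertexAsgn Φ) {Sum.inl p, Sum.inr x}) fun p x h => ?_
      rw [if_neg (by rw [Finset.card_pair (by simp)]; norm_num)]
      exact mergeVec_pair_of_gPhiAdj _ Φ p x h
end
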